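/- Let p ≥ 5 be a prime and let Γ_n(p) be the level-p principal congruence subgroup of SL_n(ℤ), i.e. the kernel of the reduction homomorphism SL_n(ℤ) → SL_n(ℤ/pℤ). Then for every n ≥ 2, the rational group cohomology in the virtual cohomological dimension is nonzero: H^{n(n−1)/2}(Γ_n(p); ℚ) ≠ 0. (Miller–Patzt–Putman) -/

import Mathlib

namespace HomogeneousCochain

/-- The simplicial coboundary of a function on `n`-tuples. -/
def coboundary {X : Type*} {n : ℕ} (f : (Fin n → X) → ℚ) (x : Fin (n + 1) → X) : ℚ :=
  ∑ i : Fin (n + 1), (-1) ^ (i : ℕ) * f fun j => x (i.succAbove j)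

section Coboundary

variable {X : Type*} {n : ℕ}

lemma coboundary_cons (f : (Fin (n + 1) → X) → ℚ) (a : X) (x : Fin (n + 1) → X) :
    coboundary f (Fin.cons a x) =
      f x - coboundary (fun y : Fin n → X => f (Fin.cons a y)) x := by
  simp only [coboundary]
  rw [Fin.sum_univ_succ, sub_eq_add_neg, ← Finset.sum_neg_distrib]
  congr 1
  · simp
  · refine Finset.sum_congr rfl fun i _ => ?_
    have : (fun j => (Fin.cons a x : Fin (n + 2) → X) (i.succ.succAbove j)) =
        Fin.cons a fun j => x (i.succAbove j) := by
      funext j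
      refine Fin.cases ?_ (fun j => ?_) j <;> simp
    rw [this, Fin.val_succ, pow_succ]
    ring

lemma coboundary_add (f g : (Fin n → X) → ℚ) :
    coboundary (f + g) = coboundary f + coboundary g := by
  funext x
  simp [coboundary, mul_add, Finset.sum_add_distrib]

lemma coboundary_smul (r : ℚ) (f : (Fin n → X) → ℚ) :
    coboundary (r • f) = r • coboundary f := by
  funext x
  simp only [coboundary, Pi.smul_apply, smul_eq_mul, Finset.mul_sum]
  exact Finset.sum_congr rfl fun i _ => by ring

lemma coboundary_sub (f g : (Fin n → X) → ℚ) :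
    coboundary (f - g) = coboundary f - coboundary g := by
  have h := coboundary_add (f - g) g
  rw [sub_add_cancel] at h
  rw [h, add_sub_cancel_right]

@[simp]
lemma coboundary_zero : coboundary (0 : (Fin n → X) → ℚ) = 0 := by
  funext x
  simp [coboundary]

lemma coboundary_coboundary (f : (Fin n → X) → ℚ) : coboundary (coboundary f) = 0 := by
  induction n with
  | zero =>
    funext x
    have : ∀ y z : Fin 0 → X, f y = f z := fun y z => congrArg f (Subsingleton.elim _ _)
    simp only [coboundary, Pi.zero_apply]
    simp [this _ default, Fin.sum_univ_succ]
  | succ n ih =>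
    funext x
    induction x using Fin.consCases with
    | _ a x =>
    have h : (fun y : Fin (n + 1) → X => coboundary f (Fin.cons a y)) =
        f - coboundary (fun y : Fin n → X => f (Fin.cons a y)) :=
      funext fun y => coboundary_cons f a y
    rw [coboundary_cons, h, coboundary_sub, ih]
    simp

end Coboundary

section Group

variable {G : Type*} [Group G] {n : ℕ}

/-- Invariance of a function on tuples under diagonal left multiplication by a subgroup. -/
def IsInvariant (H : Subgroup G) (f : (Fin n → G) → ℚ) : Prop :=
  ∀ h ∈ H, ∀ x : Fin n → G, f (fun i => h * x i) = f x

/-- Being the coboundary of an invariant function of degree one less; in degree zero only the zero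
function qualifies. -/
def IsCoboundary (H : Subgroup G) (c : (Fin (n + 1) → G) → ℚ) : Prop :=
  ∃ b : (Fin n → G) → ℚ, IsInvariant H b ∧ (n = 0 → b = 0) ∧ coboundary b = c

/-- Diagonal left translation. -/
def translate (t : G) (f : (Fin n → G) → ℚ) (x : Fin n → G) : ℚ := f fun i => t * x i

lemma IsInvariant.mono {H K : Subgroup G} (hHK : H ≤ K) {f : (Fin n → G) → ℚ}
    (hf : IsInvariant K f) : IsInvariant H f := fun h hh => hf h (hHK hh)

lemma IsInvariant.smul {H : Subgroup G} {f : (Fin n → G) → ℚ} (hf : IsInvariant H f) (r : ℚ) :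
    IsInvariant H (r • f) := fun h hh x => by
  simp [hf h hh]

lemma IsInvariant.sub {H : Subgroup G} {f g : (Fin n → G) → ℚ} (hf : IsInvariant H f)
    (hg : IsInvariant H g) : IsInvariant H (f - g) := fun h hh x => by
  simp [hf h hh, hg h hh]

lemma coboundary_translate (t : G) (f : (Fin n → G) → ℚ) :
    coboundary (translate t f) = translate t (coboundary f) := rfl

lemma IsInvariant.coboundary {H : Subgroup G} {f : (Fin n → G) → ℚ} (hf : IsInvariant H f) :
    IsInvariant H (coboundary f) := fun h hh x => by
  simp only [HomogeneousCochain.coboundary]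
  exact Finset.sum_congr rfl fun i _ => by rw [hf h hh fun j => x (i.succAbove j)]

lemma IsInvariant.translate_eq {H : Subgroup G} {f : (Fin n → G) → ℚ} (hf : IsInvariant H f)
    {t : G} (ht : t ∈ H) : translate t f = f := funext fun x => hf t ht x

lemma translate_add (t : G) (f g : (Fin n → G) → ℚ) :
    translate t (f + g) = translate t f + translate t g := rfl

lemma translate_sub (t : G) (f g : (Fin n → G) → ℚ) :
    translate t (f - g) = translate t f - translate t g := rfl

lemma translate_smul (t : G) (r : ℚ) (f : (Fin n → G) → ℚ) :
    translate t (r • f) = r • translate t f := rfl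

/-- The cohomology of `H` in degrees at least `d`, computed by `H`-invariant functions on tuples in
`G`, is concentrated in degree `d` and spanned there by the nonzero class of `v`. -/
structure IsTopClass (H : Subgroup G) (d : ℕ) (v : (Fin (d + 1) → G) → ℚ) : Prop where
  vanish : ∀ j, d < j → ∀ c : (Fin (j + 1) → G) → ℚ, IsInvariant H c → coboundary c = 0 →
    IsCoboundary H c
  span : ∀ c : (Fin (d + 1) → G) → ℚ, IsInvariant H c → coboundary c = 0 →
    ∃ r : ℚ, IsCoboundary H (c - r • v)
  not_isCoboundary : ¬ IsCoboundary H v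

lemma isTopClass_bot : IsTopClass (⊥ : Subgroup G) 0 fun _ => 1 where
  vanish := by
    intro j hj c _ hc
    obtain ⟨j, rfl⟩ := Nat.exists_eq_succ_of_ne_zero hj.ne'
    refine ⟨fun y => c (Fin.cons 1 y), fun h hh x => ?_, by simp, ?_⟩
    · simp [Subgroup.mem_bot.1 hh]
    · funext x
      have h := coboundary_cons c 1 x
      rw [hc] at h
      simp only [Pi.zero_apply] at h
      linarith
  span := by
    intro c _ hc
    refine ⟨c fun _ => 1, 0, fun _ _ _ => rfl, fun _ => rfl, ?_⟩
    funext x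
    have h := coboundary_cons c (x 0) fun _ => 1
    rw [hc] at h
    have h1 : ∀ y : Fin 0 → G, (Fin.cons (x 0) y : Fin 1 → G) = x := fun y => by
      funext j; rw [show j = 0 from Subsingleton.elim (α := Fin 1) j 0]; rfl
    simp only [Pi.zero_apply, coboundary, h1] at h
    simp at h
    simp
    linarith
  not_isCoboundary := by
    rintro ⟨b, _, hb, h⟩
    have := congrFun h fun _ => 1
    simp [hb rfl] at this

/-- A function on the integers with prescribed first difference. -/
noncomputable def antidifference (φ : ℤ → ℚ) (N : ℤ) : ℚ :=
  ∑ i ∈ Finset.Ico 0 N, φ i - ∑ i ∈ Finset.Ico N 0, φ i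

lemma antidifference_add_one (φ : ℤ → ℚ) (N : ℤ) :
    antidifference φ (N + 1) = antidifference φ N + φ N := by
  unfold antidifference
  rcases le_or_gt 0 N with h | h
  · rw [Finset.Ico_eq_empty_of_le (show (0 : ℤ) ≤ N + 1 by lia),
      Finset.Ico_eq_empty_of_le h, ← Finset.insert_Ico_right_eq_Ico_add_one h,
      Finset.sum_insert (by simp)]
    simp only [Finset.sum_empty]
    ring
  · rw [Finset.Ico_eq_empty_of_le (show N + 1 ≤ 0 by lia),
      Finset.Ico_eq_empty_of_le h.le, ← Finset.insert_Ico_add_one_left_eq_Ico h,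
      Finset.sum_insert (by simp)]
    simp only [Finset.sum_empty]
    ring

section Extension

variable {H K : Subgroup G} {t : G} {ℓ : G → ℤ}

lemma conj_zpow_mem (hHK : H ≤ K) (ht : t ∈ K) (hℓ : ∀ g ∈ K, ∀ u, ℓ (g * u) = ℓ g + ℓ u)
    (hker : ∀ g ∈ K, ℓ g = 0 ↔ g ∈ H) {h : G} (hh : h ∈ H) (k : ℤ) :
    t ^ k * h * (t ^ k)⁻¹ ∈ H := by
  have hk : t ^ k ∈ K := K.zpow_mem ht k
  have h1 : ℓ (t ^ k * (t ^ k)⁻¹) = ℓ (t ^ k) + ℓ (t ^ k)⁻¹ := hℓ _ hk _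
  have h2 : ℓ 1 = 0 := (hker 1 K.one_mem).2 H.one_mem
  rw [← hker _ (K.mul_mem (K.mul_mem hk (hHK hh)) (K.inv_mem hk)),
    hℓ _ (K.mul_mem hk (hHK hh)), hℓ _ hk, (hker h (hHK hh)).2 hh]
  rw [mul_inv_cancel, h2] at h1
  lia

lemma zpow_height (ht : t ∈ K) (hℓ : ∀ g ∈ K, ∀ u, ℓ (g * u) = ℓ g + ℓ u) (hℓt : ℓ t = 1)
    (k : ℤ) (u : G) : ℓ (t ^ k * u) = k + ℓ u := by
  induction k with
  | zero => simp
  | succ k ih => rw [add_comm, zpow_add, zpow_one, mul_assoc, hℓ t ht, ih, hℓt]; ring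
  | pred k ih =>
    have := hℓ t ht (t ^ (-(k : ℤ) - 1) * u)
    rw [← mul_assoc, ← zpow_one_add, add_sub_cancel, ih, hℓt] at this
    lia

lemma isInvariant_translate (hHK : H ≤ K) (ht : t ∈ K)
    (hℓ : ∀ g ∈ K, ∀ u, ℓ (g * u) = ℓ g + ℓ u) (hker : ∀ g ∈ K, ℓ g = 0 ↔ g ∈ H)
    {f : (Fin n → G) → ℚ} (hf : IsInvariant H f) : IsInvariant H (translate t f) := by
  intro h hh x
  have := hf _ (conj_zpow_mem hHK ht hℓ hker hh 1) fun i => t * x i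
  simpa [translate, mul_assoc] using this

lemma isInvariant_of_translate_eq (ht : t ∈ K)
    (hℓ : ∀ g ∈ K, ∀ u, ℓ (g * u) = ℓ g + ℓ u) (hℓt : ℓ t = 1)
    (hker : ∀ g ∈ K, ℓ g = 0 ↔ g ∈ H) {f : (Fin n → G) → ℚ} (hf : IsInvariant H f)
    (hft : translate t f = f) : IsInvariant K f := by
  have hz : ∀ k : ℤ, ∀ x : Fin n → G, f (fun i => t ^ k * x i) = f x := by
    have h1 : ∀ x : Fin n → G, f (fun i => t * x i) = f x := fun x => congrFun hft x
    intro k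
    induction k with
    | zero => simp
    | succ k ih =>
      intro x
      rw [← ih x, ← h1 fun i => t ^ (k : ℤ) * x i]
      congr 1; funext i
      rw [add_comm, zpow_add, zpow_one, mul_assoc]
    | pred k ih =>
      intro x
      rw [← ih x, ← h1 fun i => t ^ (-(k : ℤ) - 1) * x i]
      congr 1; funext i
      rw [← mul_assoc, ← zpow_one_add, add_sub_cancel]
  intro g hg x
  have hk := K.zpow_mem ht (-(ℓ g))
  have hmem : t ^ (-(ℓ g)) * g ∈ H := by
    rw [← hker _ (K.mul_mem hk hg), zpow_height ht hℓ hℓt]; ring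
  rw [← hf _ hmem x, ← hz (-(ℓ g)) fun i => g * x i]
  simp [mul_assoc]

lemma exists_translate_sub_eq (hHK : H ≤ K) (ht : t ∈ K)
    (hℓ : ∀ g ∈ K, ∀ u, ℓ (g * u) = ℓ g + ℓ u) (hℓt : ℓ t = 1)
    (hker : ∀ g ∈ K, ℓ g = 0 ↔ g ∈ H) {e : (Fin n → G) → ℚ} (he : IsInvariant H e)
    (hn : n = 0 → e = 0) :
    ∃ f : (Fin n → G) → ℚ, IsInvariant H f ∧ (n = 0 → f = 0) ∧ translate t f - f = e := by
  rcases n with - | n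
  · exact ⟨0, fun _ _ _ => rfl, fun _ => rfl, by
      rw [hn rfl]; funext x; simp [translate]⟩
  refine ⟨fun x => antidifference (fun k => e fun i => t ^ (k - ℓ (x 0)) * x i) (ℓ (x 0)),
    ?_, by simp, ?_⟩
  · intro h hh x
    have h0 : ℓ (h * x 0) = ℓ (x 0) := by
      rw [hℓ _ (hHK hh), (hker h (hHK hh)).2 hh, zero_add]
    simp only [h0]
    congr 1
    funext k
    rw [← he _ (conj_zpow_mem hHK ht hℓ hker hh (k - ℓ (x 0)))
      fun i => t ^ (k - ℓ (x 0)) * x i]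
    simp [mul_assoc]
  · funext x
    have h0 : ℓ (t * x 0) = ℓ (x 0) + 1 := by rw [hℓ _ ht, hℓt, add_comm]
    simp only [translate, Pi.sub_apply, h0]
    have h1 : (fun k => e fun i => t ^ (k - (ℓ (x 0) + 1)) * (t * x i)) =
        fun k => e fun i => t ^ (k - ℓ (x 0)) * x i := by
      funext k
      congr 1; funext i
      rw [← mul_assoc, ← zpow_add_one]
      congr 2; ring
    rw [h1, antidifference_add_one]
    simp

/-- The step from `H` to an extension of an infinite cyclic group by `H`. -/
theorem IsTopClass.extension (hHK : H ≤ K) (ht : t ∈ K)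
    (hℓ : ∀ g ∈ K, ∀ u, ℓ (g * u) = ℓ g + ℓ u) (hℓt : ℓ t = 1)
    (hker : ∀ g ∈ K, ℓ g = 0 ↔ g ∈ H) {d : ℕ} {v : (Fin (d + 1) → G) → ℚ}
    (hv : IsTopClass H d v) (hvK : IsInvariant K v) {s : ℚ} (hs : s ≠ 0) :
    IsTopClass K (d + 1) (coboundary fun x => s * (∑ i, (ℓ (x i) : ℚ)) * v x) := by
  have hcob : ∀ {m : ℕ} (c : (Fin (m + 2) → G) → ℚ) (β : (Fin (m + 1) → G) → ℚ),
      IsInvariant H β → coboundary β = c → IsCoboundary H (translate t β - β) →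
      IsCoboundary K c := by
    rintro m c β hβ rfl ⟨e, he, hm, hte⟩
    obtain ⟨f, hf, -, hfe⟩ := exists_translate_sub_eq hHK ht hℓ hℓt hker he hm
    refine ⟨β - coboundary f,
      isInvariant_of_translate_eq ht hℓ hℓt hker (hβ.sub hf.coboundary) ?_, by simp, ?_⟩
    · rw [translate_sub, ← coboundary_translate, ← sub_eq_zero]
      have h1 : translate t β - coboundary (translate t f) - (β - coboundary f) =
          (translate t β - β) - coboundary (translate t f - f) := by
        rw [coboundary_sub]; abel
      rw [h1, hfe, hte, sub_self]
    · rw [coboundary_sub, coboundary_coboundary, sub_zero]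
  have hdiff : ∀ {m : ℕ} (c : (Fin (m + 1) → G) → ℚ) (β : (Fin m → G) → ℚ),
      IsInvariant K c → coboundary β = c → coboundary (translate t β - β) = 0 := by
    rintro m c β hc rfl
    rw [coboundary_sub, coboundary_translate, hc.translate_eq ht, sub_self]
  set β : (Fin (d + 1) → G) → ℚ := fun x => s * (∑ i, (ℓ (x i) : ℚ)) * v x with hβ
  have hβH : IsInvariant H β := by
    intro h hh x
    have : ∀ u, ℓ (h * u) = ℓ u := fun u => by
      rw [hℓ _ (hHK hh), (hker h (hHK hh)).2 hh, zero_add]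
    simp [hβ, this, hvK h (hHK hh)]
  have hβt : translate t β - β = (s * (d + 1)) • v := by
    funext x
    have : ∀ u, ℓ (t * u) = 1 + ℓ u := fun u => by rw [hℓ _ ht, hℓt]
    simp only [translate, hβ, this, hvK t ht, Pi.sub_apply, Pi.smul_apply, smul_eq_mul,
      Int.cast_add, Int.cast_one, Finset.sum_add_distrib, Finset.sum_const, Finset.card_univ,
      Fintype.card_fin]
    push_cast [nsmul_eq_mul]
    ring
  have hμ : s * (d + 1) ≠ 0 := mul_ne_zero hs (by positivity)
  have hinvt : ∀ {m : ℕ} {f : (Fin m → G) → ℚ}, IsInvariant H f →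
      IsInvariant H (translate t f) := fun hf => isInvariant_translate hHK ht hℓ hker hf
  refine ⟨?_, ?_, ?_⟩
  · intro j hj c hc hδc
    obtain ⟨j, rfl⟩ := Nat.exists_eq_succ_of_ne_zero (Nat.ne_zero_of_lt hj)
    obtain ⟨b, hb, -, hbc⟩ := hv.vanish (j + 1) (by lia) c (hc.mono hHK) hδc
    exact hcob c b hb hbc
      (hv.vanish j (by lia) _ ((hinvt hb).sub hb) (hdiff c b hc hbc))
  · intro c hc hδc
    obtain ⟨b, hb, -, hbc⟩ := hv.vanish (d + 1) (by lia) c (hc.mono hHK) hδc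
    obtain ⟨r, hr⟩ := hv.span _ ((hinvt hb).sub hb) (hdiff c b hc hbc)
    refine ⟨r / (s * (d + 1)), hcob _ (b - (r / (s * (d + 1))) • β)
      (hb.sub (hβH.smul _)) ?_ ?_⟩
    · rw [coboundary_sub, coboundary_smul, hbc]
    · convert hr using 1
      have : translate t (b - (r / (s * (d + 1))) • β) - (b - (r / (s * (d + 1))) • β) =
          (translate t b - b) - (r / (s * (d + 1))) • (translate t β - β) := by
        rw [translate_sub, translate_smul, smul_sub]; abel
      rw [this, hβt, smul_smul, div_mul_cancel₀ _ hμ]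
  · rintro ⟨B, hB, -, hBβ⟩
    obtain ⟨r, e, he, hd, hre⟩ := hv.span (β - B) (hβH.sub (hB.mono hHK))
      (by rw [coboundary_sub, hBβ, sub_self])
    refine hv.not_isCoboundary ⟨(s * (d + 1))⁻¹ • (translate t e - e),
      ((hinvt he).sub he).smul _, fun h => by rw [hd h]; funext x; simp [translate], ?_⟩
    have h1 : β = B + r • v + coboundary e := by rw [hre]; abel
    have h2 : translate t β - β = coboundary (translate t e - e) := by
      rw [h1, translate_add, translate_add, translate_smul, hB.translate_eq ht,
        hvK.translate_eq ht, coboundary_sub, coboundary_translate]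
      abel
    rw [coboundary_smul, ← h2, hβt, smul_smul, inv_mul_cancel₀ hμ, one_smul]

end Extension

end Group

end HomogeneousCochain

namespace HomogeneousCochain

section Bridge

variable {Γ : Type} [Group Γ]

lemma inhomogeneous_d_partialProd {n : ℕ} {c : (Fin (n + 1) → Γ) → ℚ} (hc : IsInvariant ⊤ c) :
    (inhomogeneousCochains.d (Rep.trivial ℚ Γ ℚ) n).hom
      (fun g => c (Fin.partialProd g)) = fun g => coboundary c (Fin.partialProd g) := by
  funext g
  rw [inhomogeneousCochains.d_hom_apply]
  simp only [coboundary]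
  rw [Fin.sum_univ_succ (n := n + 1)]
  have h0 : c (fun j => Fin.partialProd g ((0 : Fin (n + 2)).succAbove j)) =
      c (Fin.partialProd fun i => g i.succ) := by
    rw [← hc (g 0) trivial (Fin.partialProd fun i => g i.succ)]
    congr 1
    funext j
    rw [Fin.zero_succAbove, Fin.partialProd_succ']
    rfl
  congr 1
  · simpa using h0.symm
  · refine Finset.sum_congr rfl fun j _ => ?_
    rw [Fin.partialProd_contractNth, Fin.val_succ]
    rfl

theorem nontrivial_groupCohomology {m : ℕ} {c : (Fin (m + 2) → Γ) → ℚ}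
    (hc : IsInvariant ⊤ c) (hδ : coboundary c = 0)
    (hne : ∀ b : (Fin (m + 1) → Γ) → ℚ, IsInvariant ⊤ b → coboundary b ≠ c) :
    Nontrivial (groupCohomology (Rep.trivial ℚ Γ ℚ) (m + 1)) := by
  by_contra hnt
  rw [not_nontrivial_iff_subsingleton] at hnt
  have hz : CategoryTheory.Limits.IsZero (groupCohomology (Rep.trivial ℚ Γ ℚ) (m + 1)) :=
    ModuleCat.isZero_of_subsingleton _
  have hex := (HomologicalComplex.exactAt_iff_isZero_homology _ _).2 hz
  rw [HomologicalComplex.exactAt_iff' _ m (m + 1) (m + 2) (by simp) (by simp),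
    CategoryTheory.ShortComplex.moduleCat_exact_iff] at hex
  have hd' : ∀ n, (groupCohomology.inhomogeneousCochains (Rep.trivial ℚ Γ ℚ)).d n (n + 1) =
      inhomogeneousCochains.d (Rep.trivial ℚ Γ ℚ) n :=
    groupCohomology.inhomogeneousCochains.d_def _
  obtain ⟨B, hB⟩ : ∃ B : (Fin m → Γ) → ℚ,
      (inhomogeneousCochains.d (Rep.trivial ℚ Γ ℚ) m).hom B = fun g => c (Fin.partialProd g) := by
    obtain ⟨B, hB⟩ := hex (fun g => c (Fin.partialProd g))
      ((congrArg (fun φ => φ.hom fun g => c (Fin.partialProd g)) (hd' (m + 1))).trans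
        (by rw [inhomogeneous_d_partialProd hc, hδ]; rfl))
    exact ⟨B, (congrArg (fun φ => φ.hom B) (hd' m)).symm.trans hB⟩
  have hb : IsInvariant ⊤ fun x : Fin (m + 1) → Γ => B fun i => (x i.castSucc)⁻¹ * x i.succ := by
    intro h _ x
    simp [mul_assoc]
  have hBb : (fun g => B fun i => (Fin.partialProd g i.castSucc)⁻¹ * Fin.partialProd g i.succ) =
      B := funext fun g => by simp only [Fin.partialProd_right_inv]
  have hd := inhomogeneous_d_partialProd hb
  rw [hBb] at hd
  refine hne _ hb ?_
  funext x
  rw [← Fin.partialProd_left_inv x]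
  refine (hb.coboundary (x 0) trivial _).trans (Eq.trans ?_ (hc (x 0) trivial _).symm)
  exact (congrFun hd _).symm.trans (congrFun hB _)

end Bridge

end HomogeneousCochain

namespace HomogeneousCochain

/-- An invariant function which is not an invariant coboundary is detected by a cycle. -/
theorem exists_cycle {G : Type*} [Group G] {m : ℕ} {v : (Fin (m + 1) → G) → ℚ}
    (hv : ∀ b : (Fin m → G) → ℚ, IsInvariant ⊤ b → coboundary b ≠ v) :
    ∃ z : (Fin (m + 1) → G) →₀ ℚ,
      (∀ b : (Fin m → G) → ℚ, IsInvariant ⊤ b → Finsupp.linearCombination ℚ (coboundary b) z = 0) ∧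
      Finsupp.linearCombination ℚ v z ≠ 0 := by
  let q : (Fin m → G) → MulAction.orbitRel.Quotient G (Fin m → G) := Quotient.mk _
  have hq : ∀ (g : G) (x : Fin m → G), q (fun i => g * x i) = q x := fun g x =>
    Quotient.sound ⟨g, rfl⟩
  let D : ((Fin (m + 1) → G) →₀ ℚ) →ₗ[ℚ] (MulAction.orbitRel.Quotient G (Fin m → G) →₀ ℚ) :=
    Finsupp.linearCombination ℚ fun x =>
      ∑ i : Fin (m + 1), (-1 : ℚ) ^ (i : ℕ) • Finsupp.single (q fun j => x (i.succAbove j)) 1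
  have hD : ∀ φ : (MulAction.orbitRel.Quotient G (Fin m → G) →₀ ℚ) →ₗ[ℚ] ℚ,
      φ ∘ₗ D = Finsupp.linearCombination ℚ (coboundary fun y => φ (Finsupp.single (q y) 1)) := by
    intro φ
    refine Finsupp.lhom_ext fun x r => ?_
    simp only [D, coboundary, LinearMap.comp_apply, Finsupp.linearCombination_single, map_smul,
      map_sum, smul_eq_mul]
  by_contra! hz
  have hker : Finsupp.linearCombination ℚ v ∈ (LinearMap.ker D).dualAnnihilator := by
    rw [Submodule.mem_dualAnnihilator]
    intro z hDz
    refine hz z fun b hb => ?_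
    let b' : MulAction.orbitRel.Quotient G (Fin m → G) → ℚ :=
      Quotient.lift b (by rintro _ y ⟨g, rfl⟩; exact hb g trivial y)
    have hb' : ∀ y, Finsupp.linearCombination ℚ b' (Finsupp.single (q y) 1) = b y := fun y => by
      simp [q, b']
    have := LinearMap.congr_fun (hD (Finsupp.linearCombination ℚ b')) z
    simp only [hb'] at this
    rw [← this, LinearMap.comp_apply, LinearMap.mem_ker.1 hDz, map_zero]
  rw [← LinearMap.range_dualMap_eq_dualAnnihilator_ker] at hker
  obtain ⟨φ, hφ⟩ := hker
  refine hv (fun y => φ (Finsupp.single (q y) 1)) (fun g _ x => by simp only [hq]) ?_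
  funext x
  have := LinearMap.congr_fun ((hD φ).symm.trans hφ) (Finsupp.single x 1)
  simpa using this

/-- Summation over the group turns a cochain with finite support along orbits into an invariant
one. -/
noncomputable def orbitSum {G : Type*} [Group G] {n : ℕ} (f : (Fin n → G) → ℚ) (x : Fin n → G) :
    ℚ := ∑ᶠ g : G, f fun i => g * x i

lemma isInvariant_orbitSum {G : Type*} [Group G] {n : ℕ} (f : (Fin n → G) → ℚ) :
    IsInvariant ⊤ (orbitSum f) := by
  intro h _ x
  simp only [orbitSum]
  rw [← finsum_comp_equiv (Equiv.mulRight h) (f := fun g => f fun i => g * x i)]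
  simp [mul_assoc]

lemma coboundary_orbitSum {G : Type*} [Group G] {n : ℕ} {f : (Fin n → G) → ℚ}
    (hf : ∀ x : Fin n → G, {g : G | f (fun i => g * x i) ≠ 0}.Finite) (hδ : coboundary f = 0) :
    coboundary (orbitSum f) = 0 := by
  funext x
  simp only [coboundary, orbitSum, Pi.zero_apply]
  have h1 : ∀ i : Fin (n + 1), (-1 : ℚ) ^ (i : ℕ) * ∑ᶠ g : G, f (fun j => g * x (i.succAbove j)) =
      ∑ᶠ g : G, (-1 : ℚ) ^ (i : ℕ) * f (fun j => g * x (i.succAbove j)) := fun i =>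
    mul_finsum _ _
  simp only [h1]
  rw [← finsum_sum_comm]
  · refine finsum_eq_zero_of_forall_eq_zero fun g => ?_
    exact congrFun hδ fun i => g * x i
  · intro i _
    refine (hf fun j => x (i.succAbove j)).subset fun g hg => ?_
    exact right_ne_zero_of_mul hg

end HomogeneousCochain

namespace HomogeneousCochain

/-- The determinant of the matrix of values of the first `m + 1` functions `y 0, y 1, …`. -/
def detCochain {G : Type*} (y : ℕ → G → ℚ) (m : ℕ) (x : Fin (m + 1) → G) : ℚ :=
  (Matrix.of fun i j : Fin (m + 1) => y j (x i)).det

section DetCochain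

variable {G : Type*} {y : ℕ → G → ℚ}

lemma sum_mul_detCochain (y' : G → ℚ) (m : ℕ) (x : Fin (m + 2) → G) :
    (Matrix.of fun i j : Fin (m + 2) => if j = Fin.last _ then y' (x i) else y j (x i)).det =
      (-1) ^ (m + 1) *
        ∑ i : Fin (m + 2), (-1) ^ (i : ℕ) * (y' (x i) * detCochain y m fun j => x (i.succAbove j)) := by
  rw [Matrix.det_succ_column _ (Fin.last _), Finset.mul_sum]
  refine Finset.sum_congr rfl fun i _ => ?_
  have : (Matrix.of fun i j : Fin (m + 2) =>
      if j = Fin.last _ then y' (x i) else y j (x i)).submatrix i.succAbove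
        (Fin.last (m + 1)).succAbove =
      Matrix.of fun a b : Fin (m + 1) => y b (x (i.succAbove a)) := by
    ext a b
    simp [Fin.succAbove_last, Fin.castSucc_ne_last]
  rw [this, detCochain]
  simp only [Matrix.of_apply, if_true, Fin.val_last]
  ring

lemma coboundary_detCochain (hy : y 0 = 1) (m : ℕ) : coboundary (detCochain y m) = 0 := by
  funext x
  have h := sum_mul_detCochain (y := y) 1 m x
  rw [Matrix.det_zero_of_column_eq (i := 0) (j := Fin.last _) (Fin.last_pos.ne)
    (fun i => by simp [hy, Fin.ext_iff])] at h
  have h2 : (-1 : ℚ) ^ (m + 1) ≠ 0 := pow_ne_zero _ (by norm_num)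
  have := (mul_eq_zero.1 h.symm).resolve_left h2
  simpa [coboundary] using this

lemma coboundary_sum_mul_detCochain (hy : y 0 = 1) (m : ℕ) :
    coboundary (fun x => (-1) ^ m * (∑ i, y (m + 1) (x i)) * detCochain y m x) =
      detCochain y (m + 1) := by
  funext x
  have h := sum_mul_detCochain (y := y) (y (m + 1)) m x
  have h1 : (Matrix.of fun i j : Fin (m + 2) =>
      if j = Fin.last _ then y (m + 1) (x i) else y j (x i)).det = detCochain y (m + 1) x := by
    unfold detCochain
    congr 1
    ext i j
    by_cases hj : j = Fin.last _ <;> simp [hj]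
  have h2 := congrFun (coboundary_detCochain hy m) x
  rw [← h1, h]
  simp only [coboundary, Pi.zero_apply] at h2 ⊢
  have h3 : ∀ i : Fin (m + 2), ∑ j, y (m + 1) (x (i.succAbove j)) =
      ∑ j, y (m + 1) (x j) - y (m + 1) (x i) := fun i => by
    rw [Fin.sum_univ_succAbove _ i]; ring
  simp only [h3]
  rw [Finset.mul_sum]
  have h4 : ∑ i : Fin (m + 2), (-1 : ℚ) ^ m * (∑ j, y (m + 1) (x j)) *
      ((-1) ^ (i : ℕ) * detCochain y m fun j => x (i.succAbove j)) = 0 := by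
    rw [← Finset.mul_sum, h2, mul_zero]
  rw [← sub_eq_zero, ← Finset.sum_sub_distrib, ← h4]
  refine Finset.sum_congr rfl fun i _ => ?_
  ring

lemma isInvariant_detCochain [Group G] {k : ℕ}
    (hC : ∀ g : G, ∃ C : ℕ → ℕ → ℚ, (∀ j, C j j = 1) ∧ (∀ l j, j < l → C l j = 0) ∧
      ∀ j ≤ k, ∀ u, y j (g * u) = ∑ l ∈ Finset.range (k + 1), C l j * y l u)
    {m : ℕ} (hm : m ≤ k) : IsInvariant ⊤ (detCochain y m) := by
  intro g _ x
  obtain ⟨C, hC1, hC0, hC⟩ := hC g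
  have h1 : (Matrix.of fun i j : Fin (m + 1) => y j (g * x i)) =
      (Matrix.of fun i j : Fin (m + 1) => y j (x i)) * Matrix.of fun l j : Fin (m + 1) => C l j := by
    ext i j
    rw [Matrix.mul_apply, Matrix.of_apply, hC j (by lia)]
    simp only [Matrix.of_apply]
    rw [Fin.sum_univ_eq_sum_range fun l => y l (x i) * C l j]
    rw [← Finset.sum_subset (Finset.range_subset_range.2 (show m + 1 ≤ k + 1 by lia))]
    · exact Finset.sum_congr rfl fun l _ => mul_comm _ _
    · intro l _ hl
      rw [hC0 l j (by simp at hl; lia), zero_mul]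
  have h2 : (Matrix.of fun l j : Fin (m + 1) => C l j).det = 1 := by
    rw [Matrix.det_of_isUpperTriangular]
    · simp [hC1]
    · intro l j hlj
      exact hC0 _ _ hlj
  rw [detCochain, h1, Matrix.det_mul, h2, mul_one, detCochain]

theorem isTopClass_detCochain [Group G] {k : ℕ} (hy : y 0 = 1)
    (hC : ∀ g : G, ∃ C : ℕ → ℕ → ℚ, (∀ j, C j j = 1) ∧ (∀ l j, j < l → C l j = 0) ∧
      ∀ j ≤ k, ∀ u, y j (g * u) = ∑ l ∈ Finset.range (k + 1), C l j * y l u)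
    {H : ℕ → Subgroup G} (hH0 : H 0 = ⊥) (hH : ∀ m < k, H m ≤ H (m + 1)) {s : ℚ} (hs : s ≠ 0)
    (hstep : ∀ m < k, ∃ (t : G) (ℓ : G → ℤ), t ∈ H (m + 1) ∧
      (∀ g ∈ H (m + 1), ∀ u, ℓ (g * u) = ℓ g + ℓ u) ∧ ℓ t = 1 ∧
      (∀ g ∈ H (m + 1), ℓ g = 0 ↔ g ∈ H m) ∧ ∀ u, y (m + 1) u = s * ℓ u) :
    ∀ m ≤ k, IsTopClass (H m) m (detCochain y m) := by
  intro m hm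
  induction m with
  | zero =>
    have : detCochain y 0 = fun _ => 1 := by
      funext x
      simp [detCochain, hy]
    rw [hH0, this]
    exact isTopClass_bot
  | succ m ih =>
    obtain ⟨t, ℓ, ht, hℓ, hℓt, hker, hyℓ⟩ := hstep m hm
    have := IsTopClass.extension (hH m hm) ht hℓ hℓt hker (ih (by lia))
      ((isInvariant_detCochain hC (by lia)).mono le_top)
      (mul_ne_zero (pow_ne_zero m (by norm_num : (-1 : ℚ) ≠ 0)) hs)
    rw [← coboundary_sum_mul_detCochain hy m]
    convert this using 4
    rw [Finset.sum_congr rfl fun i _ => hyℓ _, ← Finset.mul_sum]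
    ring

end DetCochain

end HomogeneousCochain

open Matrix HomogeneousCochain

section Unitriangular

variable {n : ℕ} {R : Type*} [CommRing R] {M N : Matrix (Fin n) (Fin n) R}

/-- Upper triangular matrices with unit diagonal. -/
def IsUnitriangular (M : Matrix (Fin n) (Fin n) R) : Prop :=
  M.IsUpperTriangular ∧ ∀ i, M i i = 1

lemma IsUnitriangular.one : IsUnitriangular (1 : Matrix (Fin n) (Fin n) R) :=
  ⟨Matrix.blockTriangular_one, fun i => Matrix.one_apply_eq i⟩

lemma IsUnitriangular.mul_apply (hM : IsUnitriangular M) (hN : IsUnitriangular N) {i j : Fin n}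
    (hij : i < j) : (M * N) i j = M i j + N i j + ∑ l ∈ Finset.Ioo i j, M i l * N l j := by
  rw [Matrix.mul_apply, ← Finset.sum_subset (Finset.subset_univ (Finset.Icc i j)),
    ← Finset.Ioc_insert_left hij.le, Finset.sum_insert (by simp),
    ← Finset.Ioo_insert_right hij, Finset.sum_insert (by simp), hM.2, hN.2]
  · ring
  · intro l _ hl
    rw [Finset.mem_Icc, not_and_or, not_le, not_le] at hl
    rcases hl with hl | hl
    · rw [hM.1 hl, zero_mul]
    · rw [hN.1 hl, mul_zero]

lemma IsUnitriangular.mul (hM : IsUnitriangular M) (hN : IsUnitriangular N) :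
    IsUnitriangular (M * N) := by
  refine ⟨hM.1.mul hN.1, fun i => ?_⟩
  rw [Matrix.mul_apply, Finset.sum_eq_single i, hM.2, hN.2, one_mul]
  · intro l _ hl
    rcases lt_or_gt_of_ne hl with hl | hl
    · rw [hM.1 hl, zero_mul]
    · rw [hN.1 hl, mul_zero]
  · simp

lemma IsUnitriangular.det (hM : IsUnitriangular M) : M.det = 1 := by
  rw [Matrix.det_of_isUpperTriangular hM.1]
  simp [hM.2]

lemma IsUnitriangular.of_mul_eq_one (hM : IsUnitriangular M) (h : M * N = 1) :
    IsUnitriangular N := by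
  have hNM : N * M = 1 := mul_eq_one_comm.1 h
  let : Invertible M := ⟨N, hNM, h⟩
  have hN : N.IsUpperTriangular := by
    have := Matrix.blockTriangular_inv_of_blockTriangular hM.1
    rwa [Matrix.inv_eq_right_inv h] at this
  refine ⟨hN, fun i => ?_⟩
  have h1 := congrFun (congrFun h i) i
  rw [Matrix.one_apply_eq, Matrix.mul_apply, Finset.sum_eq_single i, hM.2, one_mul] at h1
  · exact h1
  · intro l _ hl
    rcases lt_or_gt_of_ne hl with hl | hl
    · rw [hM.1 hl, zero_mul]
    · rw [hN hl, mul_zero]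
  · simp

lemma IsUnitriangular.map {S : Type*} [CommRing S] (f : R →+* S) (hM : IsUnitriangular M) :
    IsUnitriangular (M.map f) :=
  ⟨fun i j hij => by rw [Matrix.map_apply, hM.1 hij, map_zero],
    fun i => by rw [Matrix.map_apply, hM.2, map_one]⟩

end Unitriangular

section Positions

/-- The positions above the diagonal, ordered by decreasing column and then decreasing row. -/
theorem exists_posEquiv (n : ℕ) :
    ∃ e : Fin (n * (n - 1) / 2) ≃ {q : Fin n × Fin n // q.1 < q.2}, ∀ a b,
      ((e b).1.2 < (e a).1.2 ∨ (e b).1.2 = (e a).1.2 ∧ (e b).1.1 < (e a).1.1) → a < b := by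
  have hcard : Fintype.card {q : Fin n × Fin n // q.1 < q.2} = n * (n - 1) / 2 := by
    rw [← Finset.sum_range_id, ← Fin.sum_univ_eq_sum_range fun i => i]
    rw [Fintype.card_subtype, ← Finset.univ_product_univ, Finset.card_filter,
      Finset.sum_product_right]
    refine Finset.sum_congr rfl fun j _ => ?_
    rw [← Finset.card_filter, ← Fin.card_Iio j]
    congr 1
    ext i
    simp
  let f : {q : Fin n × Fin n // q.1 < q.2} → (Fin n)ᵒᵈ ×ₗ (Fin n)ᵒᵈ := fun q =>
    toLex (OrderDual.toDual q.1.2, OrderDual.toDual q.1.1)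
  have hf : Function.Injective f := by
    rintro ⟨⟨i, j⟩, h⟩ ⟨⟨i', j'⟩, h'⟩ hq
    have h1 := congrArg (fun q => (ofLex q).1.ofDual) hq
    have h2 := congrArg (fun q => (ofLex q).2.ofDual) hq
    simp only [f, ofLex_toLex, OrderDual.ofDual_toDual] at h1 h2
    subst h1 h2
    rfl
  let : LinearOrder {q : Fin n × Fin n // q.1 < q.2} := LinearOrder.lift' f hf
  let E := Fintype.orderIsoFinOfCardEq _ hcard
  refine ⟨E.toEquiv, fun a b h => ?_⟩
  refine lt_of_not_ge fun hba => not_le_of_gt (?_ : f (E a) < f (E b)) (E.map_rel_iff.2 hba)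
  rw [Prod.Lex.lt_iff]
  exact h.imp (fun h => h) fun h => ⟨h.1.symm, h.2⟩

/-- An enumeration of the positions above the diagonal, by decreasing column and then decreasing
row. -/
noncomputable def posEquiv (n : ℕ) :
    Fin (n * (n - 1) / 2) ≃ {q : Fin n × Fin n // q.1 < q.2} := (exists_posEquiv n).choose

variable {n : ℕ}

noncomputable abbrev posRow (a : Fin (n * (n - 1) / 2)) : Fin n := (posEquiv n a).1.1

noncomputable abbrev posCol (a : Fin (n * (n - 1) / 2)) : Fin n := (posEquiv n a).1.2

lemma posRow_lt_posCol (a : Fin (n * (n - 1) / 2)) : posRow a < posCol a := (posEquiv n a).2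

lemma lt_of_posCol_lt {a b : Fin (n * (n - 1) / 2)} (h : posCol b < posCol a) : a < b :=
  (exists_posEquiv n).choose_spec a b (Or.inl h)

lemma lt_of_posRow_lt {a b : Fin (n * (n - 1) / 2)} (h : posCol b = posCol a)
    (h' : posRow b < posRow a) : a < b :=
  (exists_posEquiv n).choose_spec a b (Or.inr ⟨h, h'⟩)

lemma exists_pos {i j : Fin n} (h : i < j) :
    ∃ a : Fin (n * (n - 1) / 2), posRow a = i ∧ posCol a = j :=
  ⟨(posEquiv n).symm ⟨(i, j), h⟩, by simp [posRow], by simp [posCol]⟩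

end Positions

/-- The level-`p` principal congruence subgroup of `SL_n(ℤ)`. -/
abbrev congruenceSubgroup (n p : ℕ) : Subgroup (SpecialLinearGroup (Fin n) ℤ) :=
  (SpecialLinearGroup.map (n := Fin n) (Int.castRingHom (ZMod p))).ker

/-- The underlying matrix. -/
def intMat {n : ℕ} (g : SpecialLinearGroup (Fin n) ℤ) : Matrix (Fin n) (Fin n) ℤ := g.1

lemma intMat_mul {n : ℕ} (g h : SpecialLinearGroup (Fin n) ℤ) :
    intMat (g * h) = intMat g * intMat h := rfl

lemma intMat_one {n : ℕ} : intMat (1 : SpecialLinearGroup (Fin n) ℤ) = 1 := rfl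

lemma det_intMat {n : ℕ} (g : SpecialLinearGroup (Fin n) ℤ) : (intMat g).det = 1 := g.2

lemma intMat_injective {n : ℕ} :
    Function.Injective (intMat : SpecialLinearGroup (Fin n) ℤ → Matrix (Fin n) (Fin n) ℤ) :=
  Subtype.val_injective

lemma mem_congruenceSubgroup {n p : ℕ} {g : SpecialLinearGroup (Fin n) ℤ} :
    g ∈ congruenceSubgroup n p ↔
      ∀ i j, ((intMat g i j : ℤ) : ZMod p) = (1 : Matrix (Fin n) (Fin n) (ZMod p)) i j :=
  ⟨fun h i j =>
    have h' : SpecialLinearGroup.map (Int.castRingHom (ZMod p)) g = 1 := MonoidHom.mem_ker.1 h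
    congrFun (congrFun (congrArg Subtype.val h') i) j,
    fun h => MonoidHom.mem_ker.2 (Subtype.ext (Matrix.ext h))⟩

/-- The group of upper unitriangular integer matrices congruent to the identity modulo `p`. -/
def levelUnipotent (n p : ℕ) : Subgroup (SpecialLinearGroup (Fin n) ℤ) :=
  congruenceSubgroup n p ⊓
  { carrier := {g | IsUnitriangular (intMat g)}
    mul_mem' := fun {g h} hg hh => by
      rw [Set.mem_ofPred_eq, intMat_mul]
      exact IsUnitriangular.mul hg hh
    one_mem' := IsUnitriangular.one
    inv_mem' := fun {g} hg => IsUnitriangular.of_mul_eq_one hg <| by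
      rw [← intMat_mul, mul_inv_cancel, intMat_one] }

section LevelUnipotent

variable {n p : ℕ}

lemma levelUnipotent_isUnitriangular (u : levelUnipotent n p) : IsUnitriangular (intMat u.1) := u.2.2

lemma levelUnipotent_le : levelUnipotent n p ≤ congruenceSubgroup n p := inf_le_left

lemma levelUnipotent_coe_mul (g u : levelUnipotent n p) : intMat (g * u).1 = intMat g.1 * intMat u.1 := by
  rw [Subgroup.coe_mul, intMat_mul]

lemma levelUnipotent_dvd (u : levelUnipotent n p) {i j : Fin n} (hij : i ≠ j) :
    (p : ℤ) ∣ intMat u.1 i j := by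
  have := mem_congruenceSubgroup.1 (levelUnipotent_le u.2) i j
  rwa [Matrix.one_apply_ne hij, ZMod.intCast_zmod_eq_zero_iff_dvd] at this

/-- A matrix that is unitriangular with off-diagonal entries divisible by `p`. -/
def levelUnipotentMk (M : Matrix (Fin n) (Fin n) ℤ) (hM : IsUnitriangular M)
    (hp : ∀ i j, i < j → (p : ℤ) ∣ M i j) : levelUnipotent n p :=
  ⟨⟨M, hM.det⟩, mem_congruenceSubgroup.2 fun i j => by
    change ((M i j : ℤ) : ZMod p) = _
    rcases lt_trichotomy i j with h | rfl | h
    · rw [Matrix.one_apply_ne h.ne, ZMod.intCast_zmod_eq_zero_iff_dvd]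
      exact hp i j h
    · rw [hM.2, Matrix.one_apply_eq, Int.cast_one]
    · rw [hM.1 h, Matrix.one_apply_ne h.ne', Int.cast_zero], hM⟩

lemma levelUnipotent_mul_apply (g u : levelUnipotent n p) {i j : Fin n} (hij : i < j) :
    intMat (g * u).1 i j = intMat g.1 i j + intMat u.1 i j + ∑ l ∈ Finset.Ioo i j, intMat g.1 i l * intMat u.1 l j := by
  rw [levelUnipotent_coe_mul, IsUnitriangular.mul_apply g.2.2 u.2.2 hij]

/-- The entry at an enumerated position. -/
noncomputable def posEntry (a : Fin (n * (n - 1) / 2)) (u : levelUnipotent n p) : ℤ :=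
  intMat u.1 (posRow a) (posCol a)

lemma posEntry_mul_of (a : Fin (n * (n - 1) / 2)) (g u : levelUnipotent n p)
    (hg : ∀ b, a < b → posEntry b g = 0) :
    posEntry a (g * u) = posEntry a g + posEntry a u := by
  rw [posEntry, levelUnipotent_mul_apply _ _ (posRow_lt_posCol a), Finset.sum_eq_zero, add_zero]
  · rfl
  · intro l hl
    rw [Finset.mem_Ioo] at hl
    obtain ⟨b, hb1, hb2⟩ := exists_pos hl.1
    have := hg b (lt_of_posCol_lt (by rw [hb2]; exact hl.2))
    rw [posEntry, hb1, hb2] at this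
    rw [this, zero_mul]

/-- The subgroup where the entries at positions `m`, `m + 1`, … vanish. -/
def posSubgroup (n p m : ℕ) : Subgroup (levelUnipotent n p) where
  carrier := {u | ∀ a : Fin (n * (n - 1) / 2), m ≤ a → posEntry a u = 0}
  mul_mem' := fun {g u} hg hu a ha => by
    rw [posEntry_mul_of a g u fun b hb => hg b (ha.trans hb.le), hg a ha, hu a ha, add_zero]
  one_mem' := fun a _ => Matrix.one_apply_ne (posRow_lt_posCol a).ne
  inv_mem' := fun {g} hg a ha => by
    have h := posEntry_mul_of a g g⁻¹ fun b hb => hg b (ha.trans hb.le)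
    rw [mul_inv_cancel, hg a ha, zero_add] at h
    rw [← h]
    exact Matrix.one_apply_ne (posRow_lt_posCol a).ne

lemma levelUnipotent_ext {g u : levelUnipotent n p} (h : ∀ a, posEntry a g = posEntry a u) :
    g = u := by
  refine Subtype.ext (intMat_injective (Matrix.ext fun i j => ?_))
  rcases lt_trichotomy i j with hij | rfl | hij
  · obtain ⟨a, rfl, rfl⟩ := exists_pos hij
    exact h a
  · rw [g.2.2.2, u.2.2.2]
  · rw [g.2.2.1 hij, u.2.2.1 hij]

/-- The constant function `1` followed by the entries at the enumerated positions. -/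
noncomputable def posCoord (n p : ℕ) (m : ℕ) (u : levelUnipotent n p) : ℚ :=
  match m with
  | 0 => 1
  | m + 1 => if h : m < n * (n - 1) / 2 then posEntry ⟨m, h⟩ u else 0

lemma posCoord_succ (a : Fin (n * (n - 1) / 2)) (u : levelUnipotent n p) :
    posCoord n p (a + 1) u = posEntry a u := by
  simp [posCoord]

lemma exists_posCoord_mul (g : levelUnipotent n p) :
    ∃ C : ℕ → ℕ → ℚ, (∀ j, C j j = 1) ∧ (∀ l j, j < l → C l j = 0) ∧
      ∀ j ≤ n * (n - 1) / 2, ∀ u, posCoord n p j (g * u) =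
        ∑ l ∈ Finset.range (n * (n - 1) / 2 + 1), C l j * posCoord n p l u := by
  let c : Fin (n * (n - 1) / 2) → Fin (n * (n - 1) / 2) → ℚ := fun b a =>
    if posCol b = posCol a then (intMat g.1 (posRow a) (posRow b) : ℚ) else 0
  let C : ℕ → ℕ → ℚ := fun l j => if l = j then 1 else
    if hj : j - 1 < n * (n - 1) / 2 then
      if l = 0 then posEntry ⟨j - 1, hj⟩ g else
        if hl : l - 1 < n * (n - 1) / 2 then if j = 0 then 0 else c ⟨l - 1, hl⟩ ⟨j - 1, hj⟩ else 0
    else 0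
  have hc0 : ∀ b a, a < b → c b a = 0 := by
    intro b a hab
    simp only [c]
    split_ifs with h
    · rcases lt_trichotomy (posRow a) (posRow b) with h' | h' | h'
      · exact absurd (lt_of_posRow_lt h.symm h') hab.not_gt
      · exact absurd ((posEquiv n).injective (Subtype.ext (Prod.ext h' h.symm))) hab.ne
      · rw [g.2.2.1 h', Int.cast_zero]
    · rfl
  have hc1 : ∀ a, c a a = 1 := fun a => by simp only [c, if_true, g.2.2.2, Int.cast_one]
  have hC0 : ∀ a : Fin (n * (n - 1) / 2), C 0 (a + 1) = posEntry a g := fun a => by simp [C]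
  have hCs : ∀ b a : Fin (n * (n - 1) / 2), C (b + 1) (a + 1) = c b a := fun b a => by
    by_cases h : b = a
    · subst h; simp [C, hc1]
    · have : (b : ℕ) ≠ a := fun h' => h (Fin.ext h')
      simp [C, this]
  refine ⟨C, fun j => by simp [C], fun l j hlj => ?_, fun j hj u => ?_⟩
  · simp only [C]
    rw [if_neg hlj.ne']
    split_ifs with h1 h2 h3 h4
    · lia
    · rfl
    · exact hc0 _ _ (by rw [Fin.lt_def]; simp only; lia)
    · rfl
    · rfl
  · rw [Finset.sum_range_succ']
    rcases j with - | j
    · rw [Finset.sum_eq_zero]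
      · simp [C, posCoord]
      · intro l _
        have : C (l + 1) 0 = 0 := by simp [C]
        rw [this, zero_mul]
    · obtain ⟨a, rfl⟩ : ∃ a : Fin (n * (n - 1) / 2), (a : ℕ) = j := ⟨⟨j, by lia⟩, rfl⟩
      rw [posCoord_succ, hC0, ← Fin.sum_univ_eq_sum_range
        (fun l => C (l + 1) (a + 1) * posCoord n p (l + 1) u)]
      simp only [posCoord_succ, hCs]
      rw [posEntry, levelUnipotent_mul_apply _ _ (posRow_lt_posCol a)]
      have h0 : posCoord n p 0 u = 1 := rfl
      rw [h0, mul_one]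
      have hset : ∑ b, c b a * (posEntry b u : ℚ) =
          ∑ q : {q : Fin n × Fin n // q.1 < q.2}, if q.1.2 = posCol a then
            (intMat g.1 (posRow a) q.1.1 : ℚ) * intMat u.1 q.1.1 (posCol a) else 0 := by
        rw [← (posEquiv n).sum_comp]
        refine Finset.sum_congr rfl fun b _ => ?_
        simp only [c]
        by_cases h : posCol b = posCol a
        · rw [if_pos h, if_pos h, posEntry, h]
        · rw [if_neg h, if_neg h, zero_mul]
      rw [hset]
      have hsub : ∑ q : {q : Fin n × Fin n // q.1 < q.2}, (if q.1.2 = posCol a then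
            (intMat g.1 (posRow a) q.1.1 : ℚ) * intMat u.1 q.1.1 (posCol a) else 0) =
          ∑ l ∈ Finset.Iio (posCol a), (intMat g.1 (posRow a) l : ℚ) * intMat u.1 l (posCol a) := by
        rw [← Finset.sum_filter]
        refine Finset.sum_bij (fun q _ => q.1.1) ?_ ?_ ?_ ?_
        · intro q hq
          rw [Finset.mem_filter] at hq
          rw [Finset.mem_Iio, ← hq.2]
          exact q.2
        · intro q hq q' hq' h
          rw [Finset.mem_filter] at hq hq'
          exact Subtype.ext (Prod.ext h (hq.2.trans hq'.2.symm))
        · intro l hl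
          exact ⟨⟨(l, posCol a), Finset.mem_Iio.1 hl⟩, by simp, rfl⟩
        · intro q _
          rfl
      rw [hsub, ← Finset.sum_subset (s₁ := Finset.Ico (posRow a) (posCol a))
        (fun l hl => Finset.mem_Iio.2 (Finset.mem_Ico.1 hl).2),
        ← Finset.Ioo_insert_left (posRow_lt_posCol a), Finset.sum_insert (by simp), g.2.2.2]
      · push_cast [posEntry]
        ring
      · intro l hl hl'
        rw [Finset.mem_Iio] at hl
        rw [Finset.mem_Ico, not_and_or, not_le] at hl'
        rw [g.2.2.1 (hl'.resolve_right (not_not.2 hl)), Int.cast_zero, zero_mul]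

theorem coboundary_ne_detCochain_posCoord (hp : p ≠ 0) (hn : 2 ≤ n)
    (b : (Fin (n * (n - 1) / 2) → levelUnipotent n p) → ℚ) (hb : IsInvariant ⊤ b) :
    coboundary b ≠ detCochain (posCoord n p) (n * (n - 1) / 2) := by
  have hk : n * (n - 1) / 2 ≠ 0 := by
    have : 2 * 1 ≤ n * (n - 1) := Nat.mul_le_mul hn (by lia)
    lia
  have hp' : (p : ℚ) ≠ 0 := Nat.cast_ne_zero.2 hp
  have hpz : (p : ℤ) ≠ 0 := Nat.cast_ne_zero.2 hp
  have htop := isTopClass_detCochain (y := posCoord n p) (k := n * (n - 1) / 2)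
    (H := posSubgroup n p) (s := p) rfl exists_posCoord_mul ?_ ?_ hp' ?_ _ le_rfl
  · intro h
    exact htop.not_isCoboundary ⟨b, hb.mono le_top, fun h0 => absurd h0 hk, h⟩
  · rw [eq_bot_iff]
    intro u hu
    rw [Subgroup.mem_bot]
    refine levelUnipotent_ext fun a => (hu a (Nat.zero_le _)).trans ?_
    exact (Matrix.one_apply_ne (posRow_lt_posCol a).ne).symm
  · intro m _ u hu a ha
    exact hu a (by lia)
  · intro m hm
    have hdvd : ∀ u : levelUnipotent n p, (p : ℤ) * (posEntry ⟨m, hm⟩ u / p) =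
        posEntry ⟨m, hm⟩ u := fun u =>
      Int.mul_ediv_cancel' (levelUnipotent_dvd u (posRow_lt_posCol _).ne)
    have hM : ∀ i j : Fin n, (1 + Matrix.single (posRow ⟨m, hm⟩) (posCol ⟨m, hm⟩) (p : ℤ)) i j =
        (1 : Matrix (Fin n) (Fin n) ℤ) i j +
          if posRow ⟨m, hm⟩ = i ∧ posCol ⟨m, hm⟩ = j then (p : ℤ) else 0 := fun i j => by
      rw [Matrix.add_apply, Matrix.single_apply]
    have hlt := posRow_lt_posCol (⟨m, hm⟩ : Fin (n * (n - 1) / 2))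
    refine ⟨levelUnipotentMk (1 + Matrix.single (posRow ⟨m, hm⟩) (posCol ⟨m, hm⟩) (p : ℤ))
      ⟨fun i j hij => ?_, fun i => ?_⟩ fun i j hij => ?_,
      fun u => posEntry ⟨m, hm⟩ u / p, ?_, ?_, ?_, ?_, ?_⟩
    · have hij : j < i := hij
      rw [hM, Matrix.one_apply_ne hij.ne', if_neg, add_zero]
      rintro ⟨rfl, rfl⟩
      exact hlt.not_gt hij
    · rw [hM, Matrix.one_apply_eq, if_neg, add_zero]
      rintro ⟨h, h'⟩
      exact hlt.ne (h.trans h'.symm)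
    · rw [hM, Matrix.one_apply_ne hij.ne, zero_add]
      split_ifs <;> simp
    · intro a ha
      change (1 + Matrix.single (posRow ⟨m, hm⟩) (posCol ⟨m, hm⟩) (p : ℤ)) (posRow a) (posCol a) = 0
      rw [hM, Matrix.one_apply_ne (posRow_lt_posCol a).ne, if_neg, add_zero]
      rintro ⟨h, h'⟩
      have := (posEquiv n).injective (Subtype.ext (Prod.ext h h'))
      rw [← this] at ha
      simp at ha
    · intro g hg u
      refine mul_left_cancel₀ hpz ?_
      rw [mul_add, hdvd, hdvd, hdvd]
      exact posEntry_mul_of _ _ _ fun b hb => hg b hb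
    · refine mul_left_cancel₀ hpz ?_
      rw [hdvd]
      change (1 + Matrix.single (posRow ⟨m, hm⟩) (posCol ⟨m, hm⟩) (p : ℤ)) _ _ = _
      rw [hM, Matrix.one_apply_ne hlt.ne, if_pos ⟨rfl, rfl⟩, zero_add, mul_one]
    · intro g hg
      rw [← mul_right_inj' hpz, hdvd, mul_zero]
      refine ⟨fun h a ha => ?_, fun h => h _ le_rfl⟩
      rcases ha.eq_or_lt with rfl | ha
      · exact h
      · exact hg a ha
    · intro u
      rw [posCoord_succ ⟨m, hm⟩, ← hdvd]
      push_cast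
      simp

end LevelUnipotent

section ConeCochain

variable {k : ℕ}

/-- The signed maximal minors of a `(k + 1) × k` matrix. -/
def signedMinor (w : Fin (k + 1) → Fin k → ℝ) (i : Fin (k + 1)) : ℝ :=
  (-1) ^ (i : ℕ) * (Matrix.of fun a b : Fin k => w (i.succAbove a) b).det

lemma sum_signedMinor_mul (w : Fin (k + 1) → Fin k → ℝ) (v : Fin (k + 1) → ℝ) :
    ∑ i, signedMinor w i * v i =
      (Matrix.of fun i : Fin (k + 1) => (Fin.cons (v i) (w i) : Fin (k + 1) → ℝ)).det := by
  rw [Matrix.det_succ_column_zero]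
  refine Finset.sum_congr rfl fun i _ => ?_
  simp only [signedMinor, Matrix.of_apply, Fin.cons_zero]
  have : (Matrix.of fun a b : Fin k => w (i.succAbove a) b) = Matrix.submatrix
      (Matrix.of fun i : Fin (k + 1) => (Fin.cons (v i) (w i) : Fin (k + 1) → ℝ))
      i.succAbove Fin.succ := by
    ext a b
    simp
  rw [this]
  ring

lemma sum_signedMinor_smul (w : Fin (k + 1) → Fin k → ℝ) :
    ∑ i, signedMinor w i • w i = 0 := by
  funext b
  rw [Finset.sum_apply]
  simp only [Pi.smul_apply, smul_eq_mul, Pi.zero_apply]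
  rw [sum_signedMinor_mul w fun i => w i b]
  exact Matrix.det_zero_of_column_eq (Fin.succ_ne_zero b).symm fun i => by simp

lemma sum_smul_of_apply_eq_zero {w : Fin (k + 1) → Fin k → ℝ} {c : Fin (k + 1) → ℝ}
    {i : Fin (k + 1)} (hi : c i = 0) :
    ∑ j, c j • w j =
      (fun a => c (i.succAbove a)) ᵥ* Matrix.of fun a b : Fin k => w (i.succAbove a) b := by
  rw [Fin.sum_univ_succAbove _ i, hi, zero_smul, zero_add]
  funext b
  simp [Matrix.vecMul, dotProduct, Finset.sum_apply]

lemma det_ne_zero_of_signedMinor {w : Fin (k + 1) → Fin k → ℝ} {i : Fin (k + 1)}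
    (hi : signedMinor w i ≠ 0) :
    (Matrix.of fun a b : Fin k => w (i.succAbove a) b).det ≠ 0 :=
  right_ne_zero_of_mul hi

lemma eq_smul_signedMinor {w : Fin (k + 1) → Fin k → ℝ} {i : Fin (k + 1)}
    (hi : signedMinor w i ≠ 0) {c : Fin (k + 1) → ℝ} (hc : ∑ j, c j • w j = 0) :
    c = (c i / signedMinor w i) • signedMinor w := by
  set d := c - (c i / signedMinor w i) • signedMinor w with hd
  have hdi : d i = 0 := by simp [hd, hi]
  have hdw : ∑ j, d j • w j = 0 := by
    simp only [hd, Pi.sub_apply, Pi.smul_apply, sub_smul, Finset.sum_sub_distrib, hc, smul_assoc]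
    rw [← Finset.smul_sum, sum_signedMinor_smul, smul_zero, sub_zero]
  rw [sum_smul_of_apply_eq_zero hdi] at hdw
  have h0 := Matrix.eq_zero_of_vecMul_eq_zero (det_ne_zero_of_signedMinor hi) hdw
  rw [← sub_eq_zero, ← hd]
  funext j
  rcases Fin.eq_self_or_eq_succAbove i j with rfl | ⟨a, rfl⟩
  · exact hdi
  · exact congrFun h0 a

lemma exists_sum_smul_eq {w : Fin (k + 1) → Fin k → ℝ} {i : Fin (k + 1)}
    (hi : signedMinor w i ≠ 0) (u : Fin k → ℝ) : ∃ c : Fin (k + 1) → ℝ, ∑ j, c j • w j = u := by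
  set M := Matrix.of fun a b : Fin k => w (i.succAbove a) b with hM
  have hdet : IsUnit M.det := (det_ne_zero_of_signedMinor hi).isUnit
  refine ⟨i.insertNth 0 (u ᵥ* M⁻¹), ?_⟩
  rw [sum_smul_of_apply_eq_zero (i := i) (by simp)]
  simp only [Fin.insertNth_apply_succAbove]
  change (u ᵥ* M⁻¹) ᵥ* M = u
  rw [Matrix.vecMul_vecMul, Matrix.nonsing_inv_mul _ hdet, Matrix.vecMul_one]

open Classical in
/-- The orientation of `k` vectors if the reference vector `u` is a positive combination of them,
and zero otherwise. -/
noncomputable def coneCochain (u : Fin k → ℝ) (w : Fin k → Fin k → ℝ) : ℚ :=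
  if ∃ x : Fin k → ℝ, (∀ i, 0 < x i) ∧ ∑ i, x i • w i = u then
    (SignType.sign (Matrix.of w).det : ℚ) else 0

/-- No two coefficients vanish in an expression of `u` as a linear combination. -/
def IsGenericFor (u : Fin k → ℝ) (w : Fin (k + 1) → Fin k → ℝ) : Prop :=
  ∀ c : Fin (k + 1) → ℝ, ∑ j, c j • w j = u → ∀ i j, c i = 0 → c j = 0 → i = j

/-- `u` is a positive combination of all vectors except the `i`-th. -/
def IsFacetCone (u : Fin k → ℝ) (w : Fin (k + 1) → Fin k → ℝ) (i : Fin (k + 1)) : Prop :=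
  ∃ c : Fin (k + 1) → ℝ, c i = 0 ∧ (∀ j, j ≠ i → 0 < c j) ∧ ∑ j, c j • w j = u

open Classical in
lemma sum_facet {u : Fin k → ℝ} {w : Fin (k + 1) → Fin k → ℝ} (hu : IsGenericFor u w)
    {ν : Fin (k + 1) → ℝ} (hν : ∑ j, ν j • w j = 0)
    (hker : ∀ c : Fin (k + 1) → ℝ, ∑ j, c j • w j = 0 → ∃ t : ℝ, c = t • ν) (hpos : ∃ i, 0 < ν i) :
    ∑ i, (if 0 < ν i ∧ IsFacetCone u w i then (1 : ℚ) else 0) =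
      if ∃ c : Fin (k + 1) → ℝ, (∀ j, 0 < c j) ∧ ∑ j, c j • w j = u then 1 else 0 := by
  have hadd : ∀ (c : Fin (k + 1) → ℝ) (t : ℝ), ∑ j, (c j + t * ν j) • w j = ∑ j, c j • w j := by
    intro c t
    simp only [add_smul, Finset.sum_add_distrib, mul_smul]
    rw [← Finset.smul_sum, hν, smul_zero, add_zero]
  split_ifs with hE
  · obtain ⟨c, hc, hcu⟩ := hE
    obtain ⟨i, hi, hmin⟩ := Finset.exists_min_image (Finset.univ.filter fun i => 0 < ν i)
      (fun i => c i / ν i) (hpos.imp fun i hi => by simpa using hi)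
    simp only [Finset.mem_filter, Finset.mem_univ, true_and] at hi hmin
    have hfi : IsFacetCone u w i := by
      refine ⟨fun j => c j + -(c i / ν i) * ν j, ?_, fun j hj => ?_, by rw [hadd, hcu]⟩
      · field_simp; ring
      · have hne : c j + -(c i / ν i) * ν j ≠ 0 := fun h => hj <|
          hu (fun j => c j + -(c i / ν i) * ν j) (by rw [hadd, hcu]) j i h (by field_simp; ring)
        refine lt_of_le_of_ne ?_ hne.symm
        rcases lt_or_ge 0 (ν j) with h | h
        · have := hmin j h
          rw [le_div_iff₀ h] at this
          linarith
        · have : 0 < c i / ν i := div_pos (hc i) hi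
          nlinarith [hc j]
    rw [Finset.sum_eq_single i, if_pos ⟨hi, hfi⟩]
    · rintro j - hji
      rw [if_neg]
      rintro ⟨hj, c', hc'j, hc'pos, hc'u⟩
      obtain ⟨c, hci, hcpos, hcu⟩ := hfi
      obtain ⟨t, ht⟩ := hker (c' - c) (by simp [sub_smul, hcu, hc'u])
      have h1 := congrFun ht i
      have h2 := congrFun ht j
      simp only [Pi.sub_apply, Pi.smul_apply, smul_eq_mul, hci, hc'j] at h1 h2
      have h3 := hc'pos i hji.symm
      have h4 := hcpos j hji
      have : 0 < t := by
        by_contra! h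
        nlinarith
      nlinarith
    · simp
  · refine Finset.sum_eq_zero fun i _ => if_neg ?_
    rintro ⟨hi, c, hci, hcpos, hcu⟩
    refine hE ?_
    obtain ⟨t, ht, hsmall⟩ : ∃ t : ℝ, 0 < t ∧ ∀ j, j ≠ i → 0 < c j + t * ν j := by
      have : ∀ᶠ t in nhdsWithin (0 : ℝ) (Set.Ioi 0), ∀ j, j ≠ i → 0 < c j + t * ν j := by
        rw [Filter.eventually_all]
        intro j
        by_cases hj : j = i
        · exact Filter.Eventually.of_forall fun t h => absurd hj h
        have hcont : Continuous fun t : ℝ => c j + t * ν j := by fun_prop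
        have := (hcont.tendsto 0).eventually (lt_mem_nhds
          (show 0 < c j + 0 * ν j by simpa using hcpos j hj))
        exact (this.filter_mono nhdsWithin_le_nhds).mono fun t ht _ => ht
      obtain ⟨t, h1, h2⟩ := (this.and self_mem_nhdsWithin).exists
      exact ⟨t, h2, h1⟩
    refine ⟨fun j => c j + t * ν j, fun j => ?_, by rw [hadd, hcu]⟩
    by_cases hj : j = i
    · subst hj
      simp only [hci, zero_add]
      positivity
    · exact hsmall j hj

lemma coboundary_coneCochain (u : Fin k → ℝ) (w : Fin (k + 1) → Fin k → ℝ) (i : Fin (k + 1)) :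
    (-1) ^ (i : ℕ) * coneCochain u (fun j => w (i.succAbove j)) =
      open Classical in
      (if 0 < signedMinor w i ∧ IsFacetCone u w i then 1 else 0) -
        if 0 < -signedMinor w i ∧ IsFacetCone u w i then 1 else 0 := by
  classical
  have hA : (∃ x : Fin k → ℝ, (∀ j, 0 < x j) ∧ ∑ j, x j • w (i.succAbove j) = u) ↔
      IsFacetCone u w i := by
    constructor
    · rintro ⟨x, hx, hxu⟩
      refine ⟨i.insertNth 0 x, by simp, fun j hj => ?_, ?_⟩
      · obtain ⟨a, rfl⟩ := Fin.exists_succAbove_eq hj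
        simpa using hx a
      · rw [Fin.sum_univ_succAbove _ i]
        simpa using hxu
    · rintro ⟨c, hci, hc, hcu⟩
      refine ⟨fun a => c (i.succAbove a), fun a => hc _ (Fin.succAbove_ne i a), ?_⟩
      rw [Fin.sum_univ_succAbove _ i, hci, zero_smul, zero_add] at hcu
      exact hcu
  have hsign : (-1 : ℚ) ^ (i : ℕ) *
      (SignType.sign (Matrix.of fun a b : Fin k => w (i.succAbove a) b).det : ℚ) =
      (SignType.sign (signedMinor w i) : ℚ) := by
    rw [signedMinor, sign_mul, SignType.coe_mul, sign_pow, Left.sign_neg, sign_one]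
    simp
  rw [coneCochain]
  simp only [hA]
  by_cases h : IsFacetCone u w i
  · simp only [h, if_true, and_true]
    refine hsign.trans ?_
    rcases lt_trichotomy (signedMinor w i) 0 with h | h | h
    · simp [h, h.not_gt]
    · simp [h]
    · simp [h, h.not_gt]
  · simp [h]

open Classical in
/-- The sign common to all the signed minors, or zero if there is none. -/
noncomputable def commonSign (w : Fin (k + 1) → Fin k → ℝ) : ℚ :=
  if ∀ i, 0 < signedMinor w i then 1 else if ∀ i, signedMinor w i < 0 then -1 else 0

section

variable {u : Fin k → ℝ} {w : Fin (k + 1) → Fin k → ℝ}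

lemma coboundary_coneCochain_eq_zero (hu : IsGenericFor u w) (hpos : ∃ i, 0 < signedMinor w i)
    (hneg : ∃ i, signedMinor w i < 0) : coboundary (coneCochain u) w = 0 := by
  classical
  obtain ⟨i, hi⟩ := hneg
  simp only [coboundary, coboundary_coneCochain, Finset.sum_sub_distrib]
  have h0 := sum_signedMinor_smul w
  rw [sum_facet hu h0 (fun c hc => ⟨_, eq_smul_signedMinor hi.ne hc⟩) hpos,
    sum_facet (ν := fun i => -signedMinor w i) hu (by simpa using h0)
    (fun c hc => ⟨-(c i / signedMinor w i), ?_⟩) ⟨i, by simpa using hi⟩, sub_self]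
  refine (eq_smul_signedMinor hi.ne hc).trans ?_
  funext j
  simp

lemma exists_positive_solution (h : ∀ i, 0 < signedMinor w i) (u : Fin k → ℝ) :
    ∃ c : Fin (k + 1) → ℝ, (∀ j, 0 < c j) ∧ ∑ j, c j • w j = u := by
  obtain ⟨c, hc⟩ := exists_sum_smul_eq (h 0).ne' u
  have : ∀ᶠ t in Filter.atTop, ∀ j, 0 < c j + t * signedMinor w j := by
    rw [Filter.eventually_all]
    intro j
    exact (Filter.tendsto_atTop_add_const_left _ _
      (Filter.tendsto_id.atTop_mul_const (h j))).eventually_gt_atTop 0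
  obtain ⟨t, ht⟩ := this.exists
  refine ⟨fun j => c j + t * signedMinor w j, ht, ?_⟩
  simp only [add_smul, Finset.sum_add_distrib, mul_smul]
  rw [← Finset.smul_sum, sum_signedMinor_smul, smul_zero, add_zero, hc]

lemma coboundary_coneCochain_eq_commonSign (hu : IsGenericFor u w)
    (h : ∀ i, signedMinor w i ≠ 0) : coboundary (coneCochain u) w = commonSign w := by
  classical
  unfold commonSign
  have h0 := sum_signedMinor_smul w
  split_ifs with h1 h2
  · simp only [coboundary, coboundary_coneCochain, Finset.sum_sub_distrib]
    rw [sum_facet hu h0 (fun c hc => ⟨_, eq_smul_signedMinor (h 0) hc⟩) ⟨0, h1 0⟩,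
      if_pos (exists_positive_solution h1 u)]
    simp [fun i => (h1 i).not_gt]
  · have hker : ∀ c : Fin (k + 1) → ℝ, ∑ j, c j • w j = 0 →
        ∃ t : ℝ, c = t • fun i => -signedMinor w i := fun c hc =>
      ⟨-(c 0 / signedMinor w 0), (eq_smul_signedMinor (h 0) hc).trans (by funext j; simp)⟩
    have hsol : ∃ c : Fin (k + 1) → ℝ, (∀ j, 0 < c j) ∧ ∑ j, c j • w j = u := by
      obtain ⟨c, hc⟩ := exists_sum_smul_eq (h 0) u
      have : ∀ᶠ t in Filter.atTop, ∀ j, 0 < c j + t * -signedMinor w j := by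
        rw [Filter.eventually_all]
        intro j
        exact (Filter.tendsto_atTop_add_const_left _ _
          (Filter.tendsto_id.atTop_mul_const (neg_pos.2 (h2 j)))).eventually_gt_atTop 0
      obtain ⟨t, ht⟩ := this.exists
      refine ⟨fun j => c j + t * -signedMinor w j, ht, ?_⟩
      simp only [add_smul, Finset.sum_add_distrib, mul_smul, neg_smul, smul_neg,
        Finset.sum_neg_distrib]
      rw [← Finset.smul_sum, sum_signedMinor_smul, smul_zero, neg_zero, add_zero, hc]
    simp only [coboundary, coboundary_coneCochain, Finset.sum_sub_distrib]
    rw [sum_facet (ν := fun i => -signedMinor w i) hu (by simpa using h0) hker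
      ⟨0, by simpa using h2 0⟩, if_pos hsol]
    simp [fun i => (h2 i).not_gt]
  · push Not at h1 h2
    obtain ⟨i, hi⟩ := h1
    obtain ⟨j, hj⟩ := h2
    exact coboundary_coneCochain_eq_zero hu ⟨j, hj.lt_of_ne (h j).symm⟩
      ⟨i, hi.lt_of_ne (h i)⟩

lemma exists_mem_stdSimplex_of_signedMinor (h : (∀ i, 0 ≤ signedMinor w i) ∨
    ∀ i, signedMinor w i ≤ 0) {i : Fin (k + 1)} (hi : signedMinor w i ≠ 0) :
    ∃ r ∈ stdSimplex ℝ (Fin (k + 1)), ∑ j, r j • w j = 0 := by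
  obtain ⟨ν, hν, hνi, hνw⟩ : ∃ ν : Fin (k + 1) → ℝ, (∀ i, 0 ≤ ν i) ∧ ν i ≠ 0 ∧
      ∑ j, ν j • w j = 0 := by
    have h0 := sum_signedMinor_smul w
    rcases h with h | h
    · exact ⟨_, h, hi, h0⟩
    · exact ⟨fun i => -signedMinor w i, fun i => by simpa using h i, by simpa using hi,
        by simpa using h0⟩
  have hsum : 0 < ∑ j, ν j :=
    Finset.sum_pos' (fun j _ => hν j) ⟨i, Finset.mem_univ _, (hν i).lt_of_ne hνi.symm⟩
  refine ⟨fun j => (∑ j, ν j)⁻¹ * ν j, ⟨fun j => mul_nonneg (inv_nonneg.2 hsum.le) (hν j), ?_⟩, ?_⟩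
  · rw [← Finset.mul_sum, inv_mul_cancel₀ hsum.ne']
  · simp only [mul_smul]
    rw [← Finset.smul_sum, hνw, smul_zero]

lemma exists_mem_stdSimplex_of_coboundary_ne_zero (hu : IsGenericFor u w)
    (h : coboundary (coneCochain u) w ≠ 0) :
    ∃ r ∈ stdSimplex ℝ (Fin (k + 1)), ∑ j, r j • w j = 0 := by
  classical
  have hne : ∃ i, signedMinor w i ≠ 0 := by
    by_contra! h0
    refine h ?_
    simp only [coboundary, coboundary_coneCochain]
    simp [h0]
  obtain ⟨i, hi⟩ := hne
  refine exists_mem_stdSimplex_of_signedMinor ?_ hi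
  by_contra! h'
  exact h (coboundary_coneCochain_eq_zero hu h'.2 h'.1)

lemma exists_mem_stdSimplex_of_commonSign_ne_zero (h : commonSign w ≠ 0) :
    ∃ r ∈ stdSimplex ℝ (Fin (k + 1)), ∑ j, r j • w j = 0 := by
  unfold commonSign at h
  split_ifs at h with h1 h2
  · exact exists_mem_stdSimplex_of_signedMinor (Or.inl fun i => (h1 i).le) (h1 0).ne'
  · exact exists_mem_stdSimplex_of_signedMinor (Or.inr fun i => (h2 i).le) (h2 0).ne
  · exact absurd rfl h

end

end ConeCochain

open Filter Topology MeasureTheory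

section Stability

variable {k : ℕ}

lemma continuous_signedMinor (i : Fin (k + 1)) :
    Continuous fun w : Fin (k + 1) → Fin k → ℝ => signedMinor w i := by
  unfold signedMinor
  exact continuous_const.mul (Continuous.matrix_det (by fun_prop))

lemma eventually_commonSign_eq {w₀ : Fin (k + 1) → Fin k → ℝ} (h : ∀ i, signedMinor w₀ i ≠ 0) :
    ∀ᶠ w in 𝓝 w₀, (∀ i, signedMinor w i ≠ 0) ∧ commonSign w = commonSign w₀ := by
  have : ∀ᶠ w in 𝓝 w₀, ∀ i, (0 < signedMinor w₀ i → 0 < signedMinor w i) ∧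
      (signedMinor w₀ i < 0 → signedMinor w i < 0) := by
    rw [eventually_all]
    intro i
    have hc := (continuous_signedMinor i).tendsto w₀
    rcases lt_or_gt_of_ne (h i) with hi | hi
    · exact (hc.eventually (gt_mem_nhds hi)).mono fun w hw => ⟨fun h' => absurd h' hi.not_gt,
        fun _ => hw⟩
    · exact (hc.eventually (lt_mem_nhds hi)).mono fun w hw => ⟨fun _ => hw,
        fun h' => absurd h' hi.not_gt⟩
  refine this.mono fun w hw => ⟨fun i => ?_, ?_⟩
  · rcases lt_or_gt_of_ne (h i) with hi | hi
    · exact ((hw i).2 hi).ne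
    · exact ((hw i).1 hi).ne'
  · have h1 : ∀ i, 0 < signedMinor w i ↔ 0 < signedMinor w₀ i := fun i =>
      ⟨fun h' => (lt_or_gt_of_ne (h i)).resolve_left fun h'' => ((hw i).2 h'').not_gt h', (hw i).1⟩
    have h2 : ∀ i, signedMinor w i < 0 ↔ signedMinor w₀ i < 0 := fun i =>
      ⟨fun h' => (lt_or_gt_of_ne (h i)).resolve_right fun h'' => ((hw i).1 h'').not_gt h', (hw i).2⟩
    simp only [commonSign, h1, h2]

lemma eventually_not_exists_mem_stdSimplex {w₀ : Fin (k + 1) → Fin k → ℝ}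
    (h : ¬∃ r ∈ stdSimplex ℝ (Fin (k + 1)), ∑ j, r j • w₀ j = 0) :
    ∀ᶠ w in 𝓝 w₀, ¬∃ r ∈ stdSimplex ℝ (Fin (k + 1)), ∑ j, r j • w j = 0 := by
  have hc : Continuous fun q : (Fin (k + 1) → Fin k → ℝ) × (Fin (k + 1) → ℝ) =>
      ∑ j, q.2 j • q.1 j := by fun_prop
  have := (isCompact_stdSimplex ℝ (Fin (k + 1))).eventually_forall_of_forall_eventually
    (x₀ := w₀) (P := fun w r => ∑ j, r j • w j ≠ 0) fun r hr =>
      hc.continuousAt.eventually_ne (fun h0 => h ⟨r, hr, h0⟩)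
  exact this.mono fun w hw ⟨r, hr, h0⟩ => hw r hr h0

lemma eventually_coboundary_coneCochain_eq {w₀ : Fin (k + 1) → Fin k → ℝ}
    (h : ∀ c : Fin (k + 1) → ℝ, ∑ j, c j = 1 → ∑ j, c j • w₀ j = 0 → ∀ i, c i ≠ 0) :
    ∀ᶠ w in 𝓝 w₀, ∀ u, IsGenericFor u w →
      coboundary (coneCochain u) w = commonSign w₀ := by
  by_cases hr : ∃ r ∈ stdSimplex ℝ (Fin (k + 1)), ∑ j, r j • w₀ j = 0
  · obtain ⟨r, ⟨-, hr1⟩, hr⟩ := hr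
    have hne : ∀ i, signedMinor w₀ i ≠ 0 := by
      intro i hi
      have hdet : (Matrix.of fun a b : Fin k => w₀ (i.succAbove a) b).det = 0 := by
        simpa [signedMinor] using hi
      obtain ⟨d, hd, hd0⟩ := Matrix.exists_vecMul_eq_zero_iff.2 hdet
      obtain ⟨e, hei, hed⟩ : ∃ e : Fin (k + 1) → ℝ, e i = 0 ∧ ∀ a, e (i.succAbove a) = d a :=
        ⟨i.insertNth 0 d, by simp, fun a => by simp⟩
      have he0 : ∑ j, e j • w₀ j = 0 := by
        rw [sum_smul_of_apply_eq_zero hei]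
        simpa only [hed] using hd0
      by_cases hs : ∑ j, e j = 0
      · obtain ⟨a, ha⟩ := Function.ne_iff.1 hd
        rw [← hed, Pi.zero_apply] at ha
        set j := i.succAbove a
        refine h (fun l => r l - r j / e j * e l) ?_ ?_ j ?_
        · rw [Finset.sum_sub_distrib, ← Finset.mul_sum, hs, hr1]; ring
        · simp only [sub_smul, Finset.sum_sub_distrib, mul_smul]
          rw [← Finset.smul_sum, he0, hr]; simp
        · field_simp
          ring
      · refine h (fun l => (∑ j, e j)⁻¹ * e l) ?_ ?_ i (by simp [hei])
        · rw [← Finset.mul_sum, inv_mul_cancel₀ hs]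
        · simp only [mul_smul]
          rw [← Finset.smul_sum, he0, smul_zero]
    exact (eventually_commonSign_eq hne).mono fun w hw u hu => by
      rw [coboundary_coneCochain_eq_commonSign hu hw.1, hw.2]
  · refine (eventually_not_exists_mem_stdSimplex hr).mono fun w hw u hu => ?_
    have h1 : commonSign w₀ = 0 := by
      by_contra h1
      exact hr (exists_mem_stdSimplex_of_commonSign_ne_zero h1)
    rw [h1]
    by_contra h2
    exact hw (exists_mem_stdSimplex_of_coboundary_ne_zero hu h2)

lemma signedMinor_mulVec (A : Matrix (Fin k) (Fin k) ℝ) (w : Fin (k + 1) → Fin k → ℝ)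
    (i : Fin (k + 1)) : signedMinor (fun j => A *ᵥ w j) i = A.det * signedMinor w i := by
  have : (Matrix.of fun a b : Fin k => (A *ᵥ w (i.succAbove a)) b) =
      (Matrix.of fun a b : Fin k => w (i.succAbove a) b) * Aᵀ := by
    ext a b
    simp [Matrix.mul_apply, Matrix.mulVec, dotProduct, mul_comm]
  rw [signedMinor, this, Matrix.det_mul, Matrix.det_transpose, signedMinor]
  ring

lemma commonSign_mulVec {A : Matrix (Fin k) (Fin k) ℝ} (hA : A.det ≠ 0)
    (w : Fin (k + 1) → Fin k → ℝ) :
    commonSign (fun j => A *ᵥ w j) = (SignType.sign A.det : ℚ) * commonSign w := by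
  simp only [commonSign, signedMinor_mulVec]
  rcases lt_or_gt_of_ne hA with h | h
  · have h1 : ∀ x : ℝ, 0 < A.det * x ↔ x < 0 := fun x => by
      rw [mul_pos_iff]
      simp [h, h.not_gt]
    have h2 : ∀ x : ℝ, A.det * x < 0 ↔ 0 < x := fun x => by
      rw [mul_neg_iff]
      simp [h, h.not_gt]
    simp only [h1, h2, sign_neg h]
    split_ifs with h3 h4
    · exact absurd (h3 0) (h4 0).not_gt
    all_goals simp
  · have h2 : ∀ x : ℝ, A.det * x < 0 ↔ x < 0 := fun x => by
      rw [mul_neg_iff]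
      simp [h, h.not_gt]
    simp [mul_pos_iff_of_pos_left h, h2, sign_pos h]

lemma ae_isGenericFor (hk : k ≠ 0) (w : Fin (k + 1) → Fin k → ℝ) :
    ∀ᵐ u : Fin k → ℝ, IsGenericFor u w := by
  have key : ∀ i j : Fin (k + 1), i ≠ j → ∀ᵐ u : Fin k → ℝ,
      u ∉ Submodule.span ℝ (w '' ({i, j} : Finset (Fin (k + 1)))ᶜ) := by
    intro i j hij
    rw [ae_iff]
    simp only [not_not]
    refine Measure.addHaar_submodule _ (Submodule.span ℝ (w '' ({i, j} : Finset (Fin (k + 1)))ᶜ)) ?_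
    intro htop
    have h1 := finrank_span_finset_le_card (R := ℝ) ((({i, j} : Finset (Fin (k + 1)))ᶜ).image w)
    have h2 := Finset.card_image_le (s := ({i, j} : Finset (Fin (k + 1)))ᶜ) (f := w)
    rw [Finset.card_compl, Finset.card_pair hij, Fintype.card_fin] at h2
    rw [Set.finrank, Finset.coe_image, Finset.coe_compl] at h1
    rw [htop, finrank_top, Module.finrank_fin_fun] at h1
    lia
  have : ∀ᵐ u : Fin k → ℝ, ∀ i j : Fin (k + 1), i ≠ j →
      u ∉ Submodule.span ℝ (w '' ({i, j} : Finset (Fin (k + 1)))ᶜ) := by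
    simp only [ae_all_iff]
    exact key
  refine this.mono fun u hu c hc i j hi hj => ?_
  by_contra hij
  refine hu i j hij ?_
  rw [← hc]
  refine Submodule.sum_mem _ fun l _ => ?_
  by_cases hl : l = i ∨ l = j
  · rcases hl with rfl | rfl
    · simp [hi]
    · simp [hj]
  · exact Submodule.smul_mem _ _ (Submodule.subset_span ⟨l, by simpa using hl, rfl⟩)

/-- A countable family of tuples admits a common generic vector. -/
lemma exists_forall_isGenericFor (hk : k ≠ 0) {ι : Type*} [Countable ι]
    (w : ι → Fin (k + 1) → Fin k → ℝ) : ∃ u : Fin k → ℝ, ∀ i, IsGenericFor u (w i) :=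
  (ae_all_iff.2 fun i => ae_isGenericFor hk (w i)).exists

lemma ae_ne_zero_of_sum_smul_eq (x : Fin (k + 1) → Fin k → ℝ) :
    ∀ᵐ y : Fin k → ℝ, ∀ c : Fin (k + 1) → ℝ, ∑ j, c j = 1 → ∑ j, c j • x j = y →
      ∀ i, c i ≠ 0 := by
  rcases Nat.eq_zero_or_pos k with rfl | hk
  · refine Eventually.of_forall fun y c hc _ i => ?_
    fin_cases i
    simp at hc
    simp [hc]
  have key : ∀ i : Fin (k + 1), ∀ᵐ y : Fin k → ℝ,
      y ∉ affineSpan ℝ (Set.range fun a => x (i.succAbove a)) := by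
    intro i
    rw [ae_iff]
    simp only [not_not]
    refine Measure.addHaar_affineSubspace _ (affineSpan ℝ (Set.range fun a => x (i.succAbove a))) ?_
    intro htop
    obtain ⟨m, rfl⟩ := Nat.exists_eq_succ_of_ne_zero hk.ne'
    have h1 := finrank_vectorSpan_range_le ℝ (fun a => x (i.succAbove a)) (n := m) (by simp)
    rw [← direction_affineSpan, htop, AffineSubspace.direction_top, finrank_top,
      Module.finrank_fin_fun] at h1
    lia
  refine (ae_all_iff.2 key).mono fun y hy c hc hcy i hi => hy i ?_
  rw [Fin.sum_univ_succAbove _ i, hi, zero_add] at hc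
  rw [Fin.sum_univ_succAbove _ i, hi, zero_smul, zero_add] at hcy
  have := affineCombination_mem_affineSpan (k := ℝ) (s := Finset.univ)
    (w := fun a => c (i.succAbove a)) hc (fun a => x (i.succAbove a))
  rwa [Finset.affineCombination_eq_linear_combination _ _ _ hc, hcy] at this

end Stability

section SimplexIntegral

variable {k : ℕ}

/-- The signed volume matrix of a simplex. -/
def affineMatrix (x : Fin (k + 1) → Fin k → ℝ) : Matrix (Fin (k + 1)) (Fin (k + 1)) ℝ :=
  Matrix.of fun i => (Fin.cons 1 (x i) : Fin (k + 1) → ℝ)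

lemma det_affineMatrix_sub (x : Fin (k + 1) → Fin k → ℝ) (y : Fin k → ℝ) :
    (affineMatrix fun i => x i - y).det = (affineMatrix x).det := by
  rw [← Matrix.det_transpose, ← Matrix.det_transpose (affineMatrix x)]
  refine Matrix.det_eq_of_forall_row_eq_smul_add_const (Fin.cons 0 (-y) : Fin (k + 1) → ℝ) 0
    (by simp) fun i j => ?_
  refine Fin.cases ?_ (fun a => ?_) i
  · simp [affineMatrix]
  · simp [affineMatrix, sub_eq_add_neg]

lemma sum_signedMinor_sub (x : Fin (k + 1) → Fin k → ℝ) (y : Fin k → ℝ) :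
    ∑ i, signedMinor (fun i => x i - y) i = (affineMatrix x).det := by
  rw [← det_affineMatrix_sub x y, affineMatrix, ← sum_signedMinor_mul _ fun _ => 1]
  simp

lemma det_affineMatrix (x : Fin (k + 1) → Fin k → ℝ) :
    (affineMatrix x).det = (Matrix.of fun b j : Fin k => (x j.succ - x 0) b).det := by
  rw [← sum_signedMinor_sub x (x 0), Finset.sum_eq_single 0]
  · rw [signedMinor, ← Matrix.det_transpose]
    simp [Matrix.transpose, Matrix.of_apply]
  · intro i _ hi
    obtain ⟨a, ha⟩ := Fin.exists_succAbove_eq hi.symm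
    rw [signedMinor, Matrix.det_eq_zero_of_row_eq_zero a (by simp [ha]), mul_zero]
  · simp

lemma commonSign_eq_zero_of_det {x : Fin (k + 1) → Fin k → ℝ} (hx : (affineMatrix x).det = 0)
    (y : Fin k → ℝ) : commonSign (fun i => x i - y) = 0 := by
  have h := sum_signedMinor_sub x y
  rw [hx] at h
  unfold commonSign
  split_ifs with h1 h2
  · exact absurd h (Finset.sum_pos (fun i _ => h1 i) Finset.univ_nonempty).ne'
  · exact absurd h (Finset.sum_neg (fun i _ => h2 i) Finset.univ_nonempty).ne
  · rfl

lemma support_commonSign_subset (x : Fin (k + 1) → Fin k → ℝ) :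
    Function.support (fun y => (commonSign (fun i => x i - y) : ℝ)) ⊆
      convexHull ℝ (Set.range x) := by
  intro y hy
  rw [Function.mem_support, Rat.cast_ne_zero] at hy
  obtain ⟨r, ⟨hr, hr1⟩, h⟩ := exists_mem_stdSimplex_of_commonSign_ne_zero hy
  simp only [smul_sub, Finset.sum_sub_distrib, ← Finset.sum_smul, hr1, one_smul] at h
  rw [← sub_eq_zero.1 h]
  exact (convex_convexHull ℝ _).sum_mem (fun i _ => hr i) hr1
    fun i _ => subset_convexHull ℝ _ ⟨i, rfl⟩

lemma measurable_commonSign : Measurable fun w : Fin (k + 1) → Fin k → ℝ => (commonSign w : ℝ) := by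
  have h1 : MeasurableSet {w : Fin (k + 1) → Fin k → ℝ | ∀ i, 0 < signedMinor w i} := by
    simp only [Set.ofPred_forall]
    exact MeasurableSet.iInter fun i =>
      (isOpen_lt continuous_const (continuous_signedMinor i)).measurableSet
  have h2 : MeasurableSet {w : Fin (k + 1) → Fin k → ℝ | ∀ i, signedMinor w i < 0} := by
    simp only [Set.ofPred_forall]
    exact MeasurableSet.iInter fun i =>
      (isOpen_lt (continuous_signedMinor i) continuous_const).measurableSet
  have : (fun w : Fin (k + 1) → Fin k → ℝ => (commonSign w : ℝ)) = fun w =>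
      open Classical in
      if w ∈ {w : Fin (k + 1) → Fin k → ℝ | ∀ i, 0 < signedMinor w i} then (1 : ℝ) else
        if w ∈ {w : Fin (k + 1) → Fin k → ℝ | ∀ i, signedMinor w i < 0} then -1 else 0 := by
    funext w
    simp only [commonSign, Set.mem_ofPred_eq]
    split_ifs <;> simp
  rw [this]
  exact Measurable.ite h1 measurable_const (Measurable.ite h2 measurable_const measurable_const)

lemma abs_commonSign_le (w : Fin (k + 1) → Fin k → ℝ) : ‖(commonSign w : ℝ)‖ ≤ 1 := by
  unfold commonSign
  split_ifs <;> simp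

lemma measurable_commonSign_sub (x : Fin (k + 1) → Fin k → ℝ) :
    Measurable fun y : Fin k → ℝ => (commonSign (fun i => x i - y) : ℝ) :=
  measurable_commonSign.comp (by fun_prop)

lemma integrable_commonSign (x : Fin (k + 1) → Fin k → ℝ) :
    Integrable fun y : Fin k → ℝ => (commonSign (fun i => x i - y) : ℝ) := by
  rw [← integrableOn_iff_integrable_of_support_subset (support_commonSign_subset x)]
  refine Measure.integrableOn_of_bounded (M := 1) ?_
    (measurable_commonSign_sub x).aestronglyMeasurable
    (Eventually.of_forall fun y => abs_commonSign_le _)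
  exact ((Set.finite_range x).isCompact_convexHull (𝕜 := ℝ)).measure_lt_top.ne

/-- The vertices of the standard corner simplex. -/
def cornerSimplex (k : ℕ) : Fin (k + 1) → Fin k → ℝ :=
  Fin.cons 0 fun j => Pi.single j 1

lemma det_affineMatrix_cornerSimplex : (affineMatrix (cornerSimplex k)).det = 1 := by
  rw [det_affineMatrix, ← Matrix.det_one (n := Fin k) (R := ℝ)]
  congr 1
  ext b j
  simp [cornerSimplex, Matrix.one_apply, Pi.single_apply]

lemma integral_commonSign_cornerSimplex_pos :
    0 < ∫ y : Fin k → ℝ, (commonSign (fun i => cornerSimplex k i - y) : ℝ) := by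
  set E := cornerSimplex k
  set t : Fin k → ℝ := ∑ i, ((k : ℝ) + 1)⁻¹ • E i with ht
  have hk : ((k : ℝ) + 1) ≠ 0 := by positivity
  have hminor : ∀ i, 0 < signedMinor (fun i => E i - t) i := by
    have hsum := sum_signedMinor_sub E t
    rw [det_affineMatrix_cornerSimplex] at hsum
    obtain ⟨i, hi⟩ : ∃ i, signedMinor (fun i => E i - t) i ≠ 0 := by
      by_contra! h
      simp [h] at hsum
    have h0 : ∑ j : Fin (k + 1), (fun _ => ((k : ℝ) + 1)⁻¹ : Fin (k + 1) → ℝ) j • (E j - t) = 0 := by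
      simp only [smul_sub, Finset.sum_sub_distrib]
      rw [← ht, ← Finset.sum_smul]
      simp [hk]
    have h1 := eq_smul_signedMinor hi h0
    have h2 : ∑ j : Fin (k + 1), ((k : ℝ) + 1)⁻¹ = 1 := by simp [hk]
    have h3 := congrArg (fun f : Fin (k + 1) → ℝ => ∑ j, f j) h1
    simp only [Pi.smul_apply, smul_eq_mul, ← Finset.mul_sum, hsum, mul_one] at h3
    rw [h2] at h3
    rw [← h3, one_smul] at h1
    intro j
    rw [← congrFun h1 j]
    positivity
  have hnonneg : ∀ y : Fin k → ℝ, 0 ≤ (commonSign (fun i => E i - y) : ℝ) := by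
    intro y
    have hsum := sum_signedMinor_sub E y
    rw [det_affineMatrix_cornerSimplex] at hsum
    unfold commonSign
    split_ifs with h1 h2
    · simp
    · exact absurd (Finset.sum_neg (fun i _ => h2 i) Finset.univ_nonempty)
        (by rw [hsum]; norm_num)
    · simp
  rw [integral_pos_iff_support_of_nonneg hnonneg (integrable_commonSign E)]
  have hnhds : ∀ᶠ y in 𝓝 t, ∀ i, 0 < signedMinor (fun i => E i - y) i := by
    rw [eventually_all]
    intro i
    have hc : Continuous fun y : Fin k → ℝ => signedMinor (fun i => E i - y) i :=
      (continuous_signedMinor i).comp (f := fun y : Fin k → ℝ => fun i => E i - y) (by fun_prop)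
    exact (hc.tendsto t).eventually (lt_mem_nhds (hminor i))
  refine Measure.measure_pos_of_mem_nhds volume (x := t) ?_
  filter_upwards [hnhds] with y hy
  rw [Function.mem_support, commonSign, if_pos hy]
  simp

theorem integral_commonSign (x : Fin (k + 1) → Fin k → ℝ) :
    ∫ y : Fin k → ℝ, (commonSign (fun i => x i - y) : ℝ) =
      (affineMatrix x).det *
        ∫ y : Fin k → ℝ, (commonSign (fun i => cornerSimplex k i - y) : ℝ) := by
  by_cases hx : (affineMatrix x).det = 0
  · simp [hx, commonSign_eq_zero_of_det hx]
  set A : Matrix (Fin k) (Fin k) ℝ := Matrix.of fun b j : Fin k => (x j.succ - x 0) b with hA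
  have hdet : (affineMatrix x).det = A.det := det_affineMatrix x
  rw [hdet] at hx ⊢
  have hA1 : ∀ i, A *ᵥ cornerSimplex k i = x i - x 0 := by
    intro i
    refine Fin.cases ?_ (fun j => ?_) i
    · simp [cornerSimplex]
    · funext b
      simp [cornerSimplex, hA]
  have hmap := Real.map_matrix_volume_pi_eq_smul_volume_pi hx
  have hmeas : AEMeasurable (Matrix.toLin' A) (volume : Measure (Fin k → ℝ)) :=
    (Matrix.toLin' A).continuous_of_finiteDimensional.measurable.aemeasurable
  have h1 : ∫ y : Fin k → ℝ, (commonSign (fun i => x i - x 0 - y) : ℝ) =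
      ∫ y : Fin k → ℝ, (commonSign (fun i => x i - y) : ℝ) := by
    rw [← integral_add_left_eq_self (fun y => (commonSign (fun i => x i - y) : ℝ)) (x 0)]
    simp only [sub_sub]
  have h2 := integral_map (μ := (volume : Measure (Fin k → ℝ))) hmeas
    (f := fun y => (commonSign (fun i => x i - x 0 - y) : ℝ))
    (measurable_commonSign_sub fun i => x i - x 0).aestronglyMeasurable
  rw [hmap, integral_smul_measure, h1] at h2
  have h3 : ∀ t : Fin k → ℝ, (commonSign (fun i => x i - x 0 - Matrix.toLin' A t) : ℝ) =
      (SignType.sign A.det : ℝ) * commonSign (fun i => cornerSimplex k i - t) := by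
    intro t
    have := commonSign_mulVec hx fun i => cornerSimplex k i - t
    simp only [Matrix.mulVec_sub, hA1] at this
    rw [Matrix.toLin'_apply, this]
    rcases lt_or_gt_of_ne hx with h | h <;> simp [h]
  simp only [h3] at h2
  rw [integral_const_mul] at h2
  rw [ENNReal.toReal_ofReal (abs_nonneg _), abs_inv, smul_eq_mul,
    inv_mul_eq_iff_eq_mul₀ (abs_ne_zero.2 hx), ← mul_assoc, abs_mul_sign] at h2
  exact h2

end SimplexIntegral

section PosCoordinates

variable {n p : ℕ}

/-- The unitriangular matrix with prescribed entries above the diagonal. -/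
noncomputable def posMatrix (y : Fin (n * (n - 1) / 2) → ℝ) : Matrix (Fin n) (Fin n) ℝ :=
  Matrix.of fun i j => if h : i < j then y ((posEquiv n).symm ⟨(i, j), h⟩) else if i = j then 1 else 0

/-- The entries above the diagonal. -/
noncomputable def posVec (M : Matrix (Fin n) (Fin n) ℝ) : Fin (n * (n - 1) / 2) → ℝ :=
  fun a => M (posRow a) (posCol a)

lemma isUnitriangular_posMatrix (y : Fin (n * (n - 1) / 2) → ℝ) :
    IsUnitriangular (posMatrix y) := by
  refine ⟨fun i j hij => ?_, fun i => ?_⟩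
  · have hij : j < i := hij
    simp [posMatrix, hij.not_gt, hij.ne']
  · simp [posMatrix]

lemma posVec_posMatrix (y : Fin (n * (n - 1) / 2) → ℝ) : posVec (posMatrix y) = y := by
  funext a
  simp only [posVec, posMatrix, Matrix.of_apply, posRow_lt_posCol, dif_pos]
  exact congrArg y ((posEquiv n).symm_apply_apply a)

lemma posMatrix_posVec {M : Matrix (Fin n) (Fin n) ℝ} (hM : IsUnitriangular M) :
    posMatrix (posVec M) = M := by
  ext i j
  rcases lt_trichotomy i j with h | rfl | h
  · obtain ⟨a, rfl, rfl⟩ := exists_pos h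
    exact congrFun (posVec_posMatrix (posVec M)) a
  · rw [(isUnitriangular_posMatrix _).2, hM.2]
  · rw [(isUnitriangular_posMatrix _).1 h, hM.1 h]

/-- The linear part of left multiplication by a unitriangular matrix. -/
noncomputable def posLin (q : Matrix (Fin n) (Fin n) ℝ) :
    Matrix (Fin (n * (n - 1) / 2)) (Fin (n * (n - 1) / 2)) ℝ :=
  Matrix.of fun a b => if posCol b = posCol a then q (posRow a) (posRow b) else 0

lemma posLin_apply_of_lt {q : Matrix (Fin n) (Fin n) ℝ} (hq : IsUnitriangular q)
    {a b : Fin (n * (n - 1) / 2)} (hab : a < b) : posLin q a b = 0 := by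
  rw [posLin, Matrix.of_apply]
  split_ifs with h
  · rcases lt_trichotomy (posRow a) (posRow b) with h' | h' | h'
    · exact absurd (lt_of_posRow_lt h.symm h') hab.not_gt
    · exact absurd ((posEquiv n).injective (Subtype.ext (Prod.ext h' h.symm))) hab.ne
    · exact hq.1 h'
  · rfl

lemma det_posLin {q : Matrix (Fin n) (Fin n) ℝ} (hq : IsUnitriangular q) : (posLin q).det = 1 := by
  rw [Matrix.det_of_isLowerTriangular _ fun a b hab => posLin_apply_of_lt hq hab]
  refine Finset.prod_eq_one fun a _ => ?_
  rw [posLin, Matrix.of_apply, if_pos rfl, hq.2]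

lemma posVec_mul {q M : Matrix (Fin n) (Fin n) ℝ} (hq : IsUnitriangular q)
    (hM : IsUnitriangular M) : posVec (q * M) = posLin q *ᵥ posVec M + posVec q := by
  funext a
  have hset : (posLin q *ᵥ posVec M) a = ∑ l ∈ Finset.Iio (posCol a),
      q (posRow a) l * M l (posCol a) := by
    have : (posLin q *ᵥ posVec M) a = ∑ r : {r : Fin n × Fin n // r.1 < r.2},
        if r.1.2 = posCol a then q (posRow a) r.1.1 * M r.1.1 (posCol a) else 0 := by
      rw [← (posEquiv n).sum_comp, Matrix.mulVec, dotProduct]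
      refine Finset.sum_congr rfl fun b _ => ?_
      simp only [posLin, Matrix.of_apply, posVec]
      by_cases h : posCol b = posCol a
      · rw [if_pos h, if_pos h, h]
      · rw [if_neg h, if_neg h, zero_mul]
    rw [this, ← Finset.sum_filter]
    refine Finset.sum_bij (fun r _ => r.1.1) ?_ ?_ ?_ ?_
    · intro r hr
      rw [Finset.mem_filter] at hr
      rw [Finset.mem_Iio, ← hr.2]
      exact r.2
    · intro r hr r' hr' h
      rw [Finset.mem_filter] at hr hr'
      exact Subtype.ext (Prod.ext h (hr.2.trans hr'.2.symm))
    · intro l hl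
      exact ⟨⟨(l, posCol a), Finset.mem_Iio.1 hl⟩, by simp, rfl⟩
    · intro r _
      rfl
  rw [Pi.add_apply, hset, ← Finset.sum_subset (s₁ := Finset.Ico (posRow a) (posCol a))
    (fun l hl => Finset.mem_Iio.2 (Finset.mem_Ico.1 hl).2),
    ← Finset.Ioo_insert_left (posRow_lt_posCol a), Finset.sum_insert (by simp), hq.2]
  · simp only [posVec]
    rw [IsUnitriangular.mul_apply hq hM (posRow_lt_posCol a)]
    ring
  · intro l hl hl'
    rw [Finset.mem_Iio] at hl
    rw [Finset.mem_Ico, not_and_or, not_le] at hl'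
    rw [hq.1 (hl'.resolve_right (not_not.2 hl)), zero_mul]

lemma posVec_mul_sub {q M N : Matrix (Fin n) (Fin n) ℝ} (hq : IsUnitriangular q)
    (hM : IsUnitriangular M) (hN : IsUnitriangular N) :
    posVec (q * M) - posVec (q * N) = posLin q *ᵥ (posVec M - posVec N) := by
  rw [posVec_mul hq hM, posVec_mul hq hN, Matrix.mulVec_sub]
  abel

/-- The underlying matrix, with real entries. -/
def realMat (g : SpecialLinearGroup (Fin n) ℤ) : Matrix (Fin n) (Fin n) ℝ :=
  (intMat g).map (Int.castRingHom ℝ)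

lemma realMat_apply (g : SpecialLinearGroup (Fin n) ℤ) (i j : Fin n) :
    realMat g i j = intMat g i j := rfl

lemma realMat_one : realMat (1 : SpecialLinearGroup (Fin n) ℤ) = 1 := by
  rw [realMat, intMat_one, Matrix.map_one _ (map_zero _) (map_one _)]

lemma realMat_mul (g h : SpecialLinearGroup (Fin n) ℤ) :
    realMat (g * h) = realMat g * realMat h := by
  rw [realMat, intMat_mul, Matrix.map_mul]
  rfl

lemma det_realMat (g : SpecialLinearGroup (Fin n) ℤ) : (realMat g).det = 1 := by
  rw [realMat, ← RingHom.mapMatrix_apply, ← RingHom.map_det, det_intMat, map_one]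

lemma isUnitriangular_realMat (v : levelUnipotent n p) : IsUnitriangular (realMat v.1) :=
  (levelUnipotent_isUnitriangular v).map _

noncomputable instance : MulAction (levelUnipotent n p) (Fin (n * (n - 1) / 2) → ℝ) where
  smul v y := posVec (realMat v.1 * posMatrix y)
  one_smul y := by
    change posVec (realMat (1 : levelUnipotent n p).1 * posMatrix y) = y
    rw [Subgroup.coe_one, realMat_one, Matrix.one_mul, posVec_posMatrix]
  mul_smul v w y := by
    change posVec (realMat (v * w).1 * posMatrix y) =
      posVec (realMat v.1 * posMatrix (posVec (realMat w.1 * posMatrix y)))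
    rw [posMatrix_posVec ((isUnitriangular_realMat w).mul (isUnitriangular_posMatrix y)),
      Subgroup.coe_mul, realMat_mul, Matrix.mul_assoc]

lemma levelUnipotent_smul_def (v : levelUnipotent n p) (y : Fin (n * (n - 1) / 2) → ℝ) :
    v • y = posVec (realMat v.1 * posMatrix y) := rfl

lemma levelUnipotent_smul_eq (v : levelUnipotent n p) (y : Fin (n * (n - 1) / 2) → ℝ) :
    v • y = posLin (realMat v.1) *ᵥ y + posVec (realMat v.1) := by
  rw [levelUnipotent_smul_def, posVec_mul (isUnitriangular_realMat v) (isUnitriangular_posMatrix y),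
    posVec_posMatrix]

lemma smul_posVec (v w : levelUnipotent n p) :
    v • posVec (realMat w.1) = posVec (realMat (v * w).1) := by
  rw [levelUnipotent_smul_def, posMatrix_posVec (isUnitriangular_realMat w), Subgroup.coe_mul,
    realMat_mul]

lemma smul_sub_smul (v : levelUnipotent n p) (x y : Fin (n * (n - 1) / 2) → ℝ) :
    v • x - v • y = posLin (realMat v.1) *ᵥ (x - y) := by
  rw [levelUnipotent_smul_eq, levelUnipotent_smul_eq, Matrix.mulVec_sub]
  abel

lemma measurePreserving_smul_levelUnipotent (v : levelUnipotent n p) :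
    MeasurePreserving (fun y : Fin (n * (n - 1) / 2) → ℝ => v • y) volume volume := by
  have hdet := det_posLin (isUnitriangular_realMat v)
  have h1 : MeasurePreserving (Matrix.toLin' (posLin (realMat v.1))) volume volume := by
    refine ⟨(Matrix.toLin' (posLin (realMat v.1))).continuous_of_finiteDimensional.measurable, ?_⟩
    rw [Real.map_matrix_volume_pi_eq_smul_volume_pi (by rw [hdet]; exact one_ne_zero), hdet]
    simp
  have := (measurePreserving_add_right volume (posVec (realMat v.1))).comp h1
  convert this using 2 with y
  rw [levelUnipotent_smul_eq]
  rfl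

instance : SMulInvariantMeasure (levelUnipotent n p) (Fin (n * (n - 1) / 2) → ℝ) volume :=
  ⟨fun v _ hs => (measurePreserving_smul_levelUnipotent v).measure_preimage hs.nullMeasurableSet⟩

instance : MeasurableConstSMul (levelUnipotent n p) (Fin (n * (n - 1) / 2) → ℝ) :=
  ⟨fun v => (measurePreserving_smul_levelUnipotent v).measurable⟩

lemma smul_apply_of_posEntry (a : Fin (n * (n - 1) / 2)) (v : levelUnipotent n p)
    (hv : ∀ b, a < b → posEntry b v = 0) (y : Fin (n * (n - 1) / 2) → ℝ) :
    (v • y) a = posEntry a v + y a := by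
  rw [levelUnipotent_smul_eq, Pi.add_apply, Matrix.mulVec, dotProduct,
    Finset.sum_eq_single a, add_comm]
  · rw [posLin, Matrix.of_apply, if_pos rfl, (isUnitriangular_realMat v).2, one_mul]
    rfl
  · intro b _ hba
    rw [posLin, Matrix.of_apply]
    split_ifs with h
    · rcases lt_trichotomy (posRow a) (posRow b) with h' | h' | h'
      · obtain ⟨c, hc1, hc2⟩ := exists_pos h'
        have hc := hv c (lt_of_posCol_lt (by rw [hc2, ← h]; exact posRow_lt_posCol b))
        rw [posEntry, hc1, hc2] at hc
        rw [realMat_apply, hc, Int.cast_zero, zero_mul]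
      · exact absurd ((posEquiv n).injective (Subtype.ext (Prod.ext h'.symm h))) hba
      · rw [(isUnitriangular_realMat v).1 h', zero_mul]
    · rw [zero_mul]
  · simp

lemma exists_posEntry_eq (a : Fin (n * (n - 1) / 2)) (c : ℤ) :
    ∃ t : levelUnipotent n p, posEntry a t = p * c ∧ ∀ b, b ≠ a → posEntry b t = 0 := by
  have hM : ∀ i j : Fin n, (1 + Matrix.single (posRow a) (posCol a) (p * c : ℤ)) i j =
      (1 : Matrix (Fin n) (Fin n) ℤ) i j +
        if posRow a = i ∧ posCol a = j then (p * c : ℤ) else 0 := fun i j => by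
    rw [Matrix.add_apply, Matrix.single_apply]
  have hlt := posRow_lt_posCol a
  refine ⟨levelUnipotentMk (1 + Matrix.single (posRow a) (posCol a) (p * c : ℤ))
    ⟨fun i j hij => ?_, fun i => ?_⟩ fun i j hij => ?_, ?_, fun b hb => ?_⟩
  · have hij : j < i := hij
    rw [hM, Matrix.one_apply_ne hij.ne', if_neg, add_zero]
    rintro ⟨rfl, rfl⟩
    exact hlt.not_gt hij
  · rw [hM, Matrix.one_apply_eq, if_neg, add_zero]
    rintro ⟨h, h'⟩
    exact hlt.ne (h.trans h'.symm)
  · rw [hM, Matrix.one_apply_ne hij.ne, zero_add]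
    split_ifs <;> simp
  · change (1 + Matrix.single (posRow a) (posCol a) (p * c : ℤ)) _ _ = _
    rw [hM, Matrix.one_apply_ne hlt.ne, if_pos ⟨rfl, rfl⟩, zero_add]
  · change (1 + Matrix.single (posRow a) (posCol a) (p * c : ℤ)) (posRow b) (posCol b) = 0
    rw [hM, Matrix.one_apply_ne (posRow_lt_posCol b).ne, if_neg, add_zero]
    rintro ⟨h, h'⟩
    exact hb ((posEquiv n).injective (Subtype.ext (Prod.ext h h'))).symm

/-- The box `[0, p)^k`. -/
def posBox (n p : ℕ) : Set (Fin (n * (n - 1) / 2) → ℝ) := {y | ∀ a, 0 ≤ y a ∧ y a < p}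

lemma measurableSet_posBox : MeasurableSet (posBox n p) := by
  simp only [posBox, Set.ofPred_forall]
  exact MeasurableSet.iInter fun a => (measurableSet_le measurable_const (measurable_pi_apply a)).inter
    (measurableSet_lt (measurable_pi_apply a) measurable_const)

lemma exists_smul_mem_posBox (hp : p ≠ 0) (y : Fin (n * (n - 1) / 2) → ℝ) :
    ∃ v : levelUnipotent n p, v • y ∈ posBox n p := by
  have hp' : (0 : ℝ) < p := by positivity
  suffices ∀ m ≤ n * (n - 1) / 2, ∃ v : levelUnipotent n p, ∀ a : Fin (n * (n - 1) / 2),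
      n * (n - 1) / 2 - m ≤ a → 0 ≤ (v • y) a ∧ (v • y) a < p by
    obtain ⟨v, hv⟩ := this _ le_rfl
    exact ⟨v, fun a => hv a (by simp)⟩
  intro m
  induction m with
  | zero => exact fun _ => ⟨1, fun a ha => absurd a.2 (by lia)⟩
  | succ m ih =>
    intro hm
    obtain ⟨v, hv⟩ := ih (by lia)
    set a₀ : Fin (n * (n - 1) / 2) := ⟨n * (n - 1) / 2 - (m + 1), by lia⟩ with ha₀
    obtain ⟨t, ht, ht0⟩ := exists_posEntry_eq (n := n) (p := p) a₀ (-⌊(v • y) a₀ / p⌋)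
    refine ⟨t * v, fun a ha => ?_⟩
    rw [mul_smul, smul_apply_of_posEntry a t fun b hb => ht0 b ?_]
    · by_cases h : a = a₀
      · rw [h, ht]
        push_cast
        have h1 := Int.floor_le ((v • y) a₀ / p)
        have h2 := Int.lt_floor_add_one ((v • y) a₀ / p)
        rw [le_div_iff₀ hp'] at h1
        rw [div_lt_iff₀ hp'] at h2
        constructor <;> nlinarith
      · rw [ht0 a h, Int.cast_zero, zero_add]
        refine hv a ?_
        have : (a : ℕ) ≠ a₀ := fun h' => h (Fin.ext h')
        simp only [ha₀] at this
        lia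
    · rintro rfl
      have : (a : ℕ) < a₀ := hb
      simp only [ha₀] at this
      lia

lemma eq_one_of_smul_mem_posBox {v : levelUnipotent n p} {y : Fin (n * (n - 1) / 2) → ℝ}
    (hy : y ∈ posBox n p) (hv : v • y ∈ posBox n p) : v = 1 := by
  refine levelUnipotent_ext fun a => ?_
  have h1 : posEntry a (1 : levelUnipotent n p) = 0 :=
    Matrix.one_apply_ne (posRow_lt_posCol a).ne
  rw [h1]
  induction a using (wellFounded_gt (α := Fin (n * (n - 1) / 2))).induction with
  | _ a ih =>
    have h := smul_apply_of_posEntry a v (fun b hb => ih b hb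
      (Matrix.one_apply_ne (posRow_lt_posCol b).ne)) y
    obtain ⟨c, hc⟩ := levelUnipotent_dvd v (posRow_lt_posCol a).ne
    rw [posEntry, hc] at h ⊢
    push_cast at h
    have hy := hy a
    have hv := hv a
    have hp' : (0 : ℝ) < p := hy.1.trans_lt hy.2
    have h2 : c < 1 := by
      have : (c : ℝ) < 1 := by nlinarith
      exact_mod_cast this
    have h3 : -1 < c := by
      have : (-1 : ℝ) < c := by nlinarith
      exact_mod_cast this
    have : c = 0 := by lia
    rw [this, mul_zero]

lemma isFundamentalDomain_posBox (hp : p ≠ 0) :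
    IsFundamentalDomain (levelUnipotent n p) (posBox n p) volume := by
  refine IsFundamentalDomain.mk' measurableSet_posBox.nullMeasurableSet fun y => ?_
  obtain ⟨v, hv⟩ := exists_smul_mem_posBox hp y
  refine ⟨v, hv, fun w hw => ?_⟩
  rw [← mul_inv_eq_one]
  refine eq_one_of_smul_mem_posBox hv ?_
  rw [← mul_smul, inv_mul_cancel_right]
  exact hw

instance : Countable (SpecialLinearGroup (Fin n) ℤ) :=
  Function.Injective.countable (β := Fin n → Fin n → ℤ) intMat_injective

end PosCoordinates

section GoodPoint

variable {n p : ℕ}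

/-- The local degree at `y` of the simplex with lattice vertices `x`. -/
noncomputable def latticeSign (y : Fin (n * (n - 1) / 2) → ℝ)
    (x : Fin (n * (n - 1) / 2 + 1) → levelUnipotent n p) : ℚ :=
  commonSign fun i => posVec (realMat (x i).1) - y

lemma latticeSign_smul (v : levelUnipotent n p) (y : Fin (n * (n - 1) / 2) → ℝ)
    (x : Fin (n * (n - 1) / 2 + 1) → levelUnipotent n p) :
    latticeSign (v • y) (fun i => v * x i) = latticeSign y x := by
  have hdet := det_posLin (isUnitriangular_realMat v)
  have h : (posLin (realMat v.1)).det ≠ 0 := by rw [hdet]; exact one_ne_zero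
  simp only [latticeSign, ← smul_posVec, smul_sub_smul]
  rw [commonSign_mulVec h, hdet]
  simp

lemma det_affineMatrix_posVec (x : Fin (n * (n - 1) / 2 + 1) → levelUnipotent n p) :
    (affineMatrix fun i => posVec (realMat (x i).1)).det =
      detCochain (posCoord n p) (n * (n - 1) / 2) x := by
  change _ = Rat.castHom ℝ _
  rw [detCochain, RingHom.map_det]
  congr 1
  ext i j
  refine Fin.cases ?_ (fun a => ?_) j
  · simp [affineMatrix, posCoord]
  · simp only [affineMatrix, Matrix.of_apply, Fin.cons_succ, RingHom.mapMatrix_apply,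
      Matrix.map_apply, Fin.val_succ, posCoord_succ]
    simp [posVec, posEntry, realMat_apply]

lemma setIntegral_tsum_latticeSign (hp : p ≠ 0)
    (z : (Fin (n * (n - 1) / 2 + 1) → levelUnipotent n p) →₀ ℚ) :
    ∫ y in posBox n p, ∑' v : levelUnipotent n p, ∑ x ∈ z.support,
        (z x : ℝ) * latticeSign y (fun i => v * x i) =
      Finsupp.linearCombination ℚ (detCochain (posCoord n p) (n * (n - 1) / 2)) z *
        ∫ y, (commonSign (fun i => cornerSimplex (n * (n - 1) / 2) i - y) : ℝ) := by
  have hF := isFundamentalDomain_posBox (n := n) hp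
  have hinv : ∀ (v : levelUnipotent n p) x y,
      latticeSign y (fun i => v * x i) = latticeSign (v⁻¹ • y) x := fun v x y => by
    rw [← latticeSign_smul v (v⁻¹ • y), smul_inv_smul]
  have hint : ∀ x : Fin (n * (n - 1) / 2 + 1) → levelUnipotent n p,
      Integrable fun y => (z x : ℝ) * latticeSign y x :=
    fun x => (integrable_commonSign _).const_mul _
  have hsum : Integrable fun y => ∑ x ∈ z.support, (z x : ℝ) * latticeSign y x :=
    integrable_finsetSum _ fun x _ => hint x
  have hmeas : ∀ v : levelUnipotent n p,
      Measurable fun y => ∑ x ∈ z.support, (z x : ℝ) * latticeSign (v⁻¹ • y) x :=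
    fun v => Finset.measurable_fun_sum _ fun x _ =>
      ((measurable_commonSign_sub _).comp (measurable_const_smul _)).const_mul _
  have hfin : ∑' v : levelUnipotent n p,
      ∫⁻ y in posBox n p, ‖∑ x ∈ z.support, (z x : ℝ) * latticeSign (v⁻¹ • y) x‖ₑ ≠ ⊤ := by
    rw [← hF.lintegral_eq_tsum' fun y => ‖∑ x ∈ z.support, (z x : ℝ) * latticeSign y x‖ₑ]
    exact hsum.2.ne
  simp only [hinv]
  rw [integral_tsum (fun v => (hmeas v).aestronglyMeasurable) hfin,
    ← hF.integral_eq_tsum' (fun y => ∑ x ∈ z.support, (z x : ℝ) * latticeSign y x) hsum,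
    integral_finsetSum _ fun x _ => hint x, Finsupp.linearCombination_apply, Finsupp.sum]
  push_cast
  rw [Finset.sum_mul]
  refine Finset.sum_congr rfl fun x _ => ?_
  rw [integral_const_mul]
  simp only [latticeSign]
  rw [integral_commonSign, det_affineMatrix_posVec, smul_eq_mul]
  push_cast
  ring

theorem exists_generic_point (hp : p ≠ 0)
    (z : (Fin (n * (n - 1) / 2 + 1) → levelUnipotent n p) →₀ ℚ)
    (hz : Finsupp.linearCombination ℚ (detCochain (posCoord n p) (n * (n - 1) / 2)) z ≠ 0) :
    ∃ y : Fin (n * (n - 1) / 2) → ℝ,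
      (∀ (x : Fin (n * (n - 1) / 2 + 1) → levelUnipotent n p) (c : Fin (n * (n - 1) / 2 + 1) → ℝ),
        ∑ j, c j = 1 → ∑ j, c j • posVec (realMat (x j).1) = y → ∀ i, c i ≠ 0) ∧
      ∑' v : levelUnipotent n p, ∑ x ∈ z.support,
        (z x : ℝ) * latticeSign y (fun i => v * x i) ≠ 0 := by
  have hgen : ∀ᵐ y : Fin (n * (n - 1) / 2) → ℝ,
      ∀ (x : Fin (n * (n - 1) / 2 + 1) → levelUnipotent n p) (c : Fin (n * (n - 1) / 2 + 1) → ℝ),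
        ∑ j, c j = 1 → ∑ j, c j • posVec (realMat (x j).1) = y → ∀ i, c i ≠ 0 := by
    rw [ae_all_iff]
    exact fun x => ae_ne_zero_of_sum_smul_eq _
  by_contra! hcon
  have hzero : ∀ᵐ y ∂volume.restrict (posBox n p),
      ∑' v : levelUnipotent n p, ∑ x ∈ z.support,
        (z x : ℝ) * latticeSign y (fun i => v * x i) = 0 :=
    ae_restrict_of_ae (hgen.mono fun y hy => hcon y hy)
  have h1 := integral_eq_zero_of_ae hzero
  rw [setIntegral_tsum_latticeSign hp] at h1
  have h2 := (mul_eq_zero.1 h1).resolve_right integral_commonSign_cornerSimplex_pos.ne'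
  exact hz (by exact_mod_cast h2)

end GoodPoint

section MixedGram

variable {n : ℕ} {ι : Type*} [Fintype ι]

/-- A convex combination of the symmetric matrices `γ a γᵀ` with `a` diagonal. -/
def mixedGram (a : Fin n → ℝ) (r : ι → ℝ) (γ : ι → Matrix (Fin n) (Fin n) ℝ) :
    Matrix (Fin n) (Fin n) ℝ := ∑ s, r s • (γ s * Matrix.diagonal a * (γ s)ᵀ)

variable {a : Fin n → ℝ} {r : ι → ℝ} {γ : ι → Matrix (Fin n) (Fin n) ℝ}

lemma mixedGram_mul (y : Matrix (Fin n) (Fin n) ℝ) :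
    mixedGram a r (fun s => y * γ s) = y * mixedGram a r γ * yᵀ := by
  simp only [mixedGram, Finset.mul_sum, Finset.sum_mul, Matrix.transpose_mul, Matrix.mul_smul,
    Matrix.smul_mul, Matrix.mul_assoc]

lemma mul_diagonal_mul_transpose_apply (γ : Matrix (Fin n) (Fin n) ℝ) (i j : Fin n) :
    (γ * Matrix.diagonal a * γᵀ) i j = ∑ l, γ i l * a l * γ j l := by
  rw [Matrix.mul_apply]
  simp only [Matrix.mul_diagonal, Matrix.transpose_apply]

lemma mixedGram_apply (i j : Fin n) :
    mixedGram a r γ i j = ∑ s, r s * ∑ l, γ s i l * a l * γ s j l := by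
  simp [mixedGram, Matrix.sum_apply, mul_diagonal_mul_transpose_apply]

lemma mixedGram_comm (i j : Fin n) : mixedGram a r γ i j = mixedGram a r γ j i := by
  simp only [mixedGram_apply]
  refine Finset.sum_congr rfl fun s _ => congrArg _ (Finset.sum_congr rfl fun l _ => by ring)

lemma abs_mixedGram_le (hr : r ∈ stdSimplex ℝ ι) {i j : Fin n} {C : ℝ}
    (h : ∀ s, |∑ l, γ s i l * a l * γ s j l| ≤ C) : |mixedGram a r γ i j| ≤ C := by
  rw [mixedGram_apply]
  refine (Finset.abs_sum_le_sum_abs _ _).trans ?_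
  calc ∑ s, |r s * ∑ l, γ s i l * a l * γ s j l| ≤ ∑ s, r s * C :=
        Finset.sum_le_sum fun s _ => by
          rw [abs_mul, abs_of_nonneg (hr.1 s)]
          exact mul_le_mul_of_nonneg_left (h s) (hr.1 s)
    _ = C := by rw [← Finset.sum_mul, hr.2, one_mul]

lemma le_mixedGram_diag (hr : r ∈ stdSimplex ℝ ι) {i : Fin n} {C : ℝ}
    (h : ∀ s, C ≤ ∑ l, γ s i l * a l * γ s i l) : C ≤ mixedGram a r γ i i := by
  rw [mixedGram_apply]
  calc C = ∑ s, r s * C := by rw [← Finset.sum_mul, hr.2, one_mul]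
    _ ≤ _ := Finset.sum_le_sum fun s _ => mul_le_mul_of_nonneg_left (h s) (hr.1 s)

lemma le_sum_mul_self (ha : ∀ l, 0 ≤ a l) (γ : Matrix (Fin n) (Fin n) ℝ) (i l : Fin n) :
    γ i l ^ 2 * a l ≤ ∑ l, γ i l * a l * γ i l := by
  refine le_trans (le_of_eq (by ring))
    (Finset.single_le_sum (f := fun l => γ i l * a l * γ i l) (fun l _ => ?_) (Finset.mem_univ l))
  have := mul_nonneg (sq_nonneg (γ i l)) (ha l)
  nlinarith

lemma prod_diag_eq_det {M y : Matrix (Fin n) (Fin n) ℝ} (hy : y.det = 1) {d : Fin n → ℝ}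
    (h : y * M * yᵀ = Matrix.diagonal d) : ∏ i, d i = M.det := by
  rw [← Matrix.det_diagonal, ← h, Matrix.det_mul, Matrix.det_mul, Matrix.det_transpose, hy]
  ring

lemma abs_det_le_of_row {M : Matrix (Fin n) (Fin n) ℝ} (ha : ∀ i, 0 < a i) {C : ℝ}
    (h : ∀ i j, |M i j| ≤ C * a i) : |M.det| ≤ n.factorial * C ^ n * ∏ i, a i := by
  have hM : M = Matrix.diagonal a * Matrix.of fun i j => (a i)⁻¹ * M i j := by
    ext i j
    rw [Matrix.diagonal_mul, Matrix.of_apply, mul_inv_cancel_left₀ (ha i).ne']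
  have h1 : |(Matrix.of fun i j => (a i)⁻¹ * M i j).det| ≤ n.factorial * C ^ n := by
    have := Matrix.det_le (abv := AbsoluteValue.abs (S := ℝ))
      (A := Matrix.of fun i j => (a i)⁻¹ * M i j) (x := C) fun i j => by
        rw [Matrix.of_apply, AbsoluteValue.abs_apply, abs_mul, abs_inv, abs_of_pos (ha i),
          inv_mul_le_iff₀ (ha i), mul_comm]
        exact h i j
    simpa using this
  rw [hM, Matrix.det_mul, Matrix.det_diagonal, abs_mul, mul_comm,
    abs_of_pos (Finset.prod_pos fun i _ => ha i)]
  exact mul_le_mul_of_nonneg_right h1 (Finset.prod_pos fun i _ => ha i).le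

lemma abs_mul_apply_le {A B : Matrix (Fin n) (Fin n) ℝ} {α β : ℝ} (hα : ∀ i j, |A i j| ≤ α)
    (hβ : ∀ i j, |B i j| ≤ β) (i j : Fin n) : |(A * B) i j| ≤ n * (α * β) := by
  rw [Matrix.mul_apply]
  refine (Finset.abs_sum_le_sum_abs _ _).trans ?_
  calc ∑ l, |A i l * B l j| ≤ ∑ _l : Fin n, α * β := Finset.sum_le_sum fun l _ => by
        rw [abs_mul]
        exact mul_le_mul (hα i l) (hβ l j) (abs_nonneg _) ((abs_nonneg _).trans (hα i l))
    _ = n * (α * β) := by simp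

lemma exists_abs_apply_le (A : Matrix (Fin n) (Fin n) ℝ) : ∃ C : ℝ, ∀ i j, |A i j| ≤ C :=
  ⟨∑ i, ∑ j, |A i j|, fun i j => (Finset.single_le_sum (f := fun j => |A i j|)
    (fun _ _ => abs_nonneg _) (Finset.mem_univ j)).trans
      (Finset.single_le_sum (f := fun i => ∑ j, |A i j|)
        (fun _ _ => Finset.sum_nonneg fun _ _ => abs_nonneg _) (Finset.mem_univ i))⟩

lemma finite_setOf_abs_realMat_le (C : ℝ) :
    {g : SpecialLinearGroup (Fin n) ℤ | ∀ i j, |realMat g i j| ≤ C}.Finite := by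
  have hfin : (Set.pi Set.univ fun _ : Fin n => Set.pi Set.univ fun _ : Fin n =>
      Set.Icc (-⌈C⌉) ⌈C⌉).Finite :=
    Set.Finite.pi fun _ => Set.Finite.pi fun _ => Set.finite_Icc _ _
  refine (hfin.preimage intMat_injective.injOn).subset fun g hg => ?_
  intro i _ j _
  have h := abs_le.1 (hg i j)
  rw [realMat_apply] at h
  have h1 := Int.le_ceil C
  constructor
  · have : (-⌈C⌉ : ℝ) ≤ intMat g i j := by linarith [h.1]
    exact_mod_cast this
  · have : (intMat g i j : ℝ) ≤ ⌈C⌉ := by linarith [h.2]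
    exact_mod_cast this

/-- Entries of `γ a γᵀ` for `γ` upper unitriangular with decreasing weights. -/
lemma abs_sum_unitriangular_le {γ : Matrix (Fin n) (Fin n) ℝ} (hγ : IsUnitriangular γ) {B : ℝ}
    (hB : ∀ i j, |γ i j| ≤ B) (ha : ∀ i, 0 < a i) (hanti : Antitone a) (i j : Fin n) :
    |∑ l, γ i l * a l * γ j l| ≤ n * B ^ 2 * a i := by
  refine (Finset.abs_sum_le_sum_abs _ _).trans ?_
  have hB0 : 0 ≤ B := (abs_nonneg _).trans (hB i i)
  calc ∑ l, |γ i l * a l * γ j l| ≤ ∑ _l : Fin n, B ^ 2 * a i := Finset.sum_le_sum fun l _ => ?_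
    _ = n * B ^ 2 * a i := by simp [mul_assoc]
  by_cases h : l < i
  · rw [hγ.1 h]
    have := ha i
    simp only [zero_mul, abs_zero]
    positivity
  · rw [abs_mul, abs_mul, abs_of_pos (ha l)]
    calc |γ i l| * a l * |γ j l| ≤ B * a i * B := by
          have := hanti (not_lt.1 h)
          have h1 := hB i l
          have h2 := hB j l
          have h3 := ha l
          have h4 : 0 ≤ B * a i := mul_nonneg hB0 (ha i).le
          gcongr
      _ = B ^ 2 * a i := by ring

end MixedGram

section DiagonalMixedGram

variable {n : ℕ} {ι : Type*} [Fintype ι] {a : Fin n → ℝ} {r : ι → ℝ}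

/-- The matrix `m * q` has integer entries. -/
def HasDenominator (m : ℕ) (q : Matrix (Fin n) (Fin n) ℝ) : Prop :=
  ∃ Q : Matrix (Fin n) (Fin n) ℤ, ∀ i j, (m : ℝ) * q i j = Q i j

lemma HasDenominator.mul_realMat {m : ℕ} {q : Matrix (Fin n) (Fin n) ℝ} (hq : HasDenominator m q)
    (g : SpecialLinearGroup (Fin n) ℤ) : HasDenominator m (q * realMat g) := by
  obtain ⟨Q, hQ⟩ := hq
  refine ⟨Q * intMat g, fun i j => ?_⟩
  rw [Matrix.mul_apply, Matrix.mul_apply, Finset.mul_sum, Int.cast_sum]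
  refine Finset.sum_congr rfl fun l _ => ?_
  rw [← mul_assoc, hQ, realMat_apply, Int.cast_mul]

lemma HasDenominator.one_le_sq {m : ℕ} {q : Matrix (Fin n) (Fin n) ℝ} (hq : HasDenominator m q)
    (hm : 0 < m) {i j : Fin n} (h : q i j ≠ 0) : 1 ≤ (m : ℝ) ^ 2 * q i j ^ 2 := by
  obtain ⟨Q, hQ⟩ := hq
  rw [← mul_pow, hQ]
  have h1 : Q i j ≠ 0 := by
    intro h0
    have := hQ i j
    rw [h0, Int.cast_zero, mul_eq_zero] at this
    exact this.elim (by positivity) h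
  have h2 : 1 ≤ Q i j ^ 2 := by
    have := sq_pos_of_ne_zero h1
    omega
  exact_mod_cast h2

lemma exists_row_ne_zero {y : Matrix (Fin n) (Fin n) ℝ} (hy : y.det = 1) (i : Fin n) :
    ∃ j, y i j ≠ 0 := by
  by_contra! h
  rw [Matrix.det_eq_zero_of_row_eq_zero i h] at hy
  exact zero_ne_one hy

lemma exists_pos_forall_le {ι : Type*} [Finite ι] (a : ι → ℝ) (ha : ∀ i, 0 < a i) :
    ∃ δ, 0 < δ ∧ ∀ i, δ ≤ a i := by
  have h : ∀ᶠ δ in nhdsWithin (0 : ℝ) (Set.Ioi 0), ∀ i, δ ≤ a i :=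
    Filter.eventually_all.2 fun i =>
      Filter.mem_of_superset (Ioc_mem_nhdsGT (ha i)) fun δ hδ => hδ.2
  obtain ⟨δ, h1, h2⟩ := (h.and self_mem_nhdsWithin).exists
  exact ⟨δ, h2, h1⟩

lemma exists_stdSimplex_inv_card_le (hr : r ∈ stdSimplex ℝ ι) :
    ∃ s, (Fintype.card ι : ℝ)⁻¹ ≤ r s := by
  have hne : Nonempty ι := by
    by_contra h
    rw [not_nonempty_iff] at h
    have := hr.2
    rw [Fintype.sum_empty] at this
    exact zero_ne_one this
  obtain ⟨s, -, hs⟩ := Finset.exists_le_of_sum_le (s := (Finset.univ : Finset ι))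
    (f := fun _ => (Fintype.card ι : ℝ)⁻¹) (g := r) Finset.univ_nonempty (by
      rw [hr.2]
      simp)
  exact ⟨s, hs⟩

lemma finite_setOf_abs_mul_realMat_mul_le {q : Matrix (Fin n) (Fin n) ℝ} (hq : q.det = 1)
    (γ : SpecialLinearGroup (Fin n) ℤ) (C : ℝ) :
    {g : SpecialLinearGroup (Fin n) ℤ | ∀ i j, |(q * realMat (g * γ)) i j| ≤ C}.Finite := by
  obtain ⟨C₁, hC₁⟩ := exists_abs_apply_le q⁻¹
  obtain ⟨C₂, hC₂⟩ := exists_abs_apply_le (realMat γ⁻¹)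
  refine (finite_setOf_abs_realMat_le (n * (n * (C₁ * C) * C₂))).subset fun g hg i j => ?_
  have : realMat g = q⁻¹ * (q * realMat (g * γ)) * realMat γ⁻¹ := by
    rw [Matrix.nonsing_inv_mul_cancel_left _ _ (by rw [hq]; exact isUnit_one), ← realMat_mul,
      mul_inv_cancel_right]
  rw [this]
  exact abs_mul_apply_le (abs_mul_apply_le hC₁ hg) hC₂ i j

lemma finite_setOf_mixedGram_diagonal {q : Matrix (Fin n) (Fin n) ℝ} (hq : q.det = 1) {m : ℕ}
    (hm : 0 < m) (hqm : HasDenominator m q) (ha : ∀ i, 0 < a i)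
    (γ : ι → SpecialLinearGroup (Fin n) ℤ) :
    {g : SpecialLinearGroup (Fin n) ℤ | ∃ r ∈ stdSimplex ℝ ι, ∃ d,
      mixedGram a r (fun s => q * realMat (g * γ s)) = Matrix.diagonal d}.Finite := by
  obtain ⟨δ, hδ, hδa⟩ := exists_pos_forall_le a ha
  choose C hC using fun s => exists_abs_apply_le (realMat (γ s) * Matrix.diagonal a * (realMat (γ s))ᵀ)
  set C' : ℝ := ∑ s, |C s|
  have hC' : ∀ s i j, |∑ l, realMat (γ s) i l * a l * realMat (γ s) j l| ≤ C' := fun s i j => by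
    rw [← mul_diagonal_mul_transpose_apply]
    exact (hC s i j).trans ((le_abs_self _).trans
      (Finset.single_le_sum (f := fun s => |C s|) (fun _ _ => abs_nonneg _) (Finset.mem_univ s)))
  have hm' : (0 : ℝ) < m := Nat.cast_pos.2 hm
  set η : ℝ := δ / m ^ 2
  have hη : 0 < η := by positivity
  set U : ℝ := n.factorial * C' ^ n / η ^ (n - 1)
  refine (Set.finite_iUnion fun s => finite_setOf_abs_mul_realMat_mul_le hq (γ s)
    (√(U * Fintype.card ι / δ))).subset ?_
  rintro g ⟨r, hr, d, hd⟩
  set y := q * realMat g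
  have hy : y.det = 1 := by rw [Matrix.det_mul, hq, det_realMat, one_mul]
  have hym : ∀ s, y * realMat (γ s) = q * realMat (g * γ s) := fun s => by
    rw [realMat_mul, Matrix.mul_assoc]
  have hdiag : y * mixedGram a r (fun s => realMat (γ s)) * yᵀ = Matrix.diagonal d := by
    rw [← mixedGram_mul, ← hd]
    simp only [hym]
  have hd' : ∀ i, d i = mixedGram a r (fun s => q * realMat (g * γ s)) i i := fun i => by
    rw [hd, Matrix.diagonal_apply_eq]
  have hlow : ∀ i, η ≤ d i := by
    intro i
    rw [hd']
    refine le_mixedGram_diag hr fun s => ?_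
    obtain ⟨l, hl⟩ := exists_row_ne_zero (y := q * realMat (g * γ s))
      (by rw [Matrix.det_mul, hq, det_realMat, one_mul]) i
    refine le_trans ?_ (le_sum_mul_self (fun l => (ha l).le) _ i l)
    have h1 := (hqm.mul_realMat (g * γ s)).one_le_sq hm hl
    rw [div_le_iff₀ (by positivity)]
    calc δ ≤ a l := hδa l
      _ = 1 * a l := (one_mul _).symm
      _ ≤ (m ^ 2 * (q * realMat (g * γ s)) i l ^ 2) * a l := mul_le_mul_of_nonneg_right h1 (ha l).le
      _ = _ := by ring
  have hdet : ∏ i, d i ≤ n.factorial * C' ^ n := by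
    rw [prod_diag_eq_det hy hdiag]
    refine (le_abs_self _).trans ?_
    have := abs_det_le_of_row (M := mixedGram a r (fun s => realMat (γ s))) (a := fun _ => 1)
      (fun _ => one_pos) (C := C') fun i j => by
        rw [mul_one]
        exact abs_mixedGram_le hr fun s => hC' s i j
    simpa using this
  have hup : ∀ i, d i ≤ U := by
    intro i
    rw [le_div_iff₀ (by positivity)]
    refine le_trans ?_ hdet
    rw [← Finset.mul_prod_erase _ _ (Finset.mem_univ i)]
    refine mul_le_mul_of_nonneg_left ?_ (hη.le.trans (hlow i))
    calc η ^ (n - 1) = ∏ _j ∈ Finset.univ.erase i, η := by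
          rw [Finset.prod_const, Finset.card_erase_of_mem (Finset.mem_univ i), Finset.card_univ,
            Fintype.card_fin]
      _ ≤ _ := Finset.prod_le_prod (fun _ _ => hη.le) fun j _ => hlow j
  obtain ⟨s, hs⟩ := exists_stdSimplex_inv_card_le hr
  refine Set.mem_iUnion.2 ⟨s, fun i l => Real.abs_le_sqrt ?_⟩
  set Y := fun s => q * realMat (g * γ s)
  have hcard : (0 : ℝ) < Fintype.card ι := by
    have : Nonempty ι := ⟨s⟩
    exact_mod_cast Fintype.card_pos
  have hterm : r s * (Y s i l ^ 2 * a l) ≤ U := by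
    refine le_trans ?_ (hup i)
    rw [hd', mixedGram_apply]
    refine (mul_le_mul_of_nonneg_left (le_sum_mul_self (fun l => (ha l).le) (Y s) i l)
      (hr.1 s)).trans (Finset.single_le_sum (f := fun s => r s * ∑ l, Y s i l * a l * Y s i l)
      (fun s _ => mul_nonneg (hr.1 s) (Finset.sum_nonneg fun l _ => ?_)) (Finset.mem_univ s))
    have := mul_nonneg (sq_nonneg (Y s i l)) (ha l).le
    nlinarith
  rw [le_div_iff₀ hδ, ← div_le_iff₀ hcard, div_eq_inv_mul]
  refine le_trans ?_ hterm
  have h1 := hδa l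
  have h2 := ha l
  have h3 := hr.1 s
  gcongr

end DiagonalMixedGram

section UnipotentMixedGram

variable {n : ℕ} {ι : Type*} [Fintype ι] {a : Fin n → ℝ} {r : ι → ℝ}

lemma le_diag_of_apply_ne_zero {m : ℕ} (hm : 0 < m) {y : Matrix (Fin n) (Fin n) ℝ}
    (hym : HasDenominator m y) (ha : ∀ i, 0 < a i) (hanti : Antitone a)
    (hr : r ∈ stdSimplex ℝ ι) {γ : ι → Matrix (Fin n) (Fin n) ℝ} (hγ : ∀ s, IsUnitriangular (γ s))
    {i j : Fin n} (hij : y i j ≠ 0) :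
    a j ≤ m ^ 2 * mixedGram a r (fun s => y * γ s) i i := by
  classical
  obtain ⟨l, hl, hmin⟩ := Finset.exists_min_image (Finset.univ.filter fun l => y i l ≠ 0) id
    ⟨j, by simpa using hij⟩
  rw [Finset.mem_filter] at hl
  have hmin' : ∀ l', l' < l → y i l' = 0 := fun l' h => by
    by_contra h0
    exact (hmin l' (by simpa using h0)).not_gt h
  have hlj : l ≤ j := hmin j (by simpa using hij)
  have hm' : (0 : ℝ) < m := Nat.cast_pos.2 hm
  rw [← div_le_iff₀' (by positivity)]
  refine le_mixedGram_diag hr fun s => le_trans ?_ (le_sum_mul_self (fun l => (ha l).le) _ i l)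
  have hentry : (y * γ s) i l = y i l := by
    rw [Matrix.mul_apply, Finset.sum_eq_single l, (hγ s).2, mul_one]
    · intro l' _ hne
      rcases lt_or_gt_of_ne hne with h | h
      · rw [hmin' l' h, zero_mul]
      · rw [(hγ s).1 h, mul_zero]
    · simp
  rw [hentry, div_le_iff₀ (by positivity)]
  have h1 := hym.one_le_sq hm hl.2
  calc a j ≤ a l := hanti hlj
    _ = 1 * a l := (one_mul _).symm
    _ ≤ (m ^ 2 * y i l ^ 2) * a l := mul_le_mul_of_nonneg_right h1 (ha l).le
    _ = _ := by ring

lemma apply_eq_zero_of_mixedGram_diagonal {m : ℕ} (hm : 0 < m) {y : Matrix (Fin n) (Fin n) ℝ}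
    (hy : y.det = 1) (hym : HasDenominator m y) (ha : ∀ i, 0 < a i) {ε : ℝ} (hε0 : 0 < ε)
    (hε1 : ε ≤ 1) (hε : ∀ i j, i < j → a j ≤ ε * a i) {B : ℝ}
    (hεB : (m : ℝ) ^ (2 * n) * (n.factorial * (n * B ^ 2) ^ n) * ε < 1)
    (hr : r ∈ stdSimplex ℝ ι) {γ : ι → Matrix (Fin n) (Fin n) ℝ} (hγ : ∀ s, IsUnitriangular (γ s))
    (hB : ∀ s i j, |γ s i j| ≤ B) {d : Fin n → ℝ}
    (hd : mixedGram a r (fun s => y * γ s) = Matrix.diagonal d) {σ : Equiv.Perm (Fin n)}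
    (hσ : ∀ i, y i (σ i) ≠ 0) {i j : Fin n} (hij : j < σ i) : y i j = 0 := by
  by_contra h0
  have hanti : Antitone a := fun i j h => by
    rcases h.eq_or_lt with rfl | h
    · exact le_rfl
    · have := hε i j h
      have := ha i
      nlinarith
  have hd' : ∀ i, d i = mixedGram a r (fun s => y * γ s) i i := fun i => by
    rw [hd, Matrix.diagonal_apply_eq]
  have hm' : (0 : ℝ) < m := Nat.cast_pos.2 hm
  have hlow : ∀ i, a (σ i) ≤ m ^ 2 * d i := fun i => by
    rw [hd']
    exact le_diag_of_apply_ne_zero hm hym ha hanti hr hγ (hσ i)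
  have hlow' : a (σ i) ≤ ε * (m ^ 2 * d i) := by
    refine (hε _ _ hij).trans (mul_le_mul_of_nonneg_left ?_ hε0.le)
    rw [hd']
    exact le_diag_of_apply_ne_zero hm hym ha hanti hr hγ h0
  have hprod : ∏ i, a i ≤ ε * (m ^ (2 * n) * ∏ i, d i) := by
    have h1 : ∏ i, a i = a (σ i) * ∏ l ∈ Finset.univ.erase i, a (σ l) := by
      rw [Finset.mul_prod_erase _ (fun l => a (σ l)) (Finset.mem_univ i), Equiv.prod_comp σ a]
    have h2 : (m : ℝ) ^ (2 * n) * ∏ i, d i =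
        (m ^ 2 * d i) * ∏ l ∈ Finset.univ.erase i, (m ^ 2 * d l) := by
      rw [Finset.mul_prod_erase _ (fun l => (m : ℝ) ^ 2 * d l) (Finset.mem_univ i),
        Finset.prod_mul_distrib, Finset.prod_const, Finset.card_univ, Fintype.card_fin, pow_mul]
    rw [h1, h2, ← mul_assoc]
    exact mul_le_mul hlow' (Finset.prod_le_prod (fun l _ => (ha _).le) fun l _ => hlow l)
      (Finset.prod_nonneg fun l _ => (ha _).le) ((ha _).le.trans hlow')
  have hdet : ∏ i, d i ≤ n.factorial * (n * B ^ 2) ^ n * ∏ i, a i := by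
    rw [prod_diag_eq_det hy (M := mixedGram a r γ) (by rw [← mixedGram_mul, hd])]
    refine (le_abs_self _).trans (abs_det_le_of_row ha fun i j => ?_)
    exact abs_mixedGram_le hr fun s => abs_sum_unitriangular_le (hγ s) (hB s) ha hanti i j
  have hA : 0 < ∏ i, a i := Finset.prod_pos fun i _ => ha i
  have : ∏ i, a i ≤ ((m : ℝ) ^ (2 * n) * (n.factorial * (n * B ^ 2) ^ n) * ε) * ∏ i, a i :=
    calc ∏ i, a i ≤ ε * (m ^ (2 * n) * ∏ i, d i) := hprod
      _ ≤ ε * (m ^ (2 * n) * (n.factorial * (n * B ^ 2) ^ n * ∏ i, a i)) := by gcongr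
      _ = _ := by ring
  nlinarith

lemma perm_eq_one_of_le {σ : Equiv.Perm (Fin n)} (h : ∀ i, i ≤ σ i) : σ = 1 := by
  have h1 : ∑ i, ((i : Fin n) : ℕ) = ∑ i, ((σ i : Fin n) : ℕ) :=
    (Equiv.sum_comp σ fun i => (i : ℕ)).symm
  have h2 := (Finset.sum_eq_sum_iff_of_le (s := Finset.univ) (f := fun i : Fin n => (i : ℕ))
    (g := fun i => ((σ i : Fin n) : ℕ)) fun i _ => h i).1 h1
  exact Equiv.ext fun i => (Fin.ext (h2 i (Finset.mem_univ i))).symm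

lemma abs_prod_perm_eq_one {y : Matrix (Fin n) (Fin n) ℝ} (hy : y.det = 1)
    {σ : Equiv.Perm (Fin n)} (hσ : ∀ i j, j < σ i → y i j = 0) : |∏ i, y i (σ i)| = 1 := by
  have hT : (y.submatrix σ.symm id).IsUpperTriangular := fun i j hij =>
    hσ _ _ (by rwa [Equiv.apply_symm_apply])
  have h := Matrix.det_of_isUpperTriangular hT
  rw [Matrix.det_permute, hy, mul_one] at h
  have h1 : ∏ i, y i (σ i) = ∏ i, y.submatrix σ.symm id i i := by
    rw [← Equiv.prod_comp σ fun i => y.submatrix σ.symm id i i]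
    simp
  rw [h1, ← h]
  rcases Int.units_eq_one_or (Equiv.Perm.sign σ.symm) with h | h <;> rw [h] <;> simp

lemma exists_perm_apply_ne_zero {y : Matrix (Fin n) (Fin n) ℝ} (hy : y.det = 1) :
    ∃ σ : Equiv.Perm (Fin n), ∀ i, y i (σ i) ≠ 0 := by
  by_contra! h
  rw [← Matrix.det_transpose, Matrix.det_apply, Finset.sum_eq_zero] at hy
  · exact zero_ne_one hy
  · intro σ _
    obtain ⟨i, hi⟩ := h σ
    rw [Finset.prod_eq_zero (Finset.mem_univ i) (by simpa using hi), smul_zero]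

lemma mem_levelUnipotent_of_mixedGram_diagonal {p : ℕ} (hp : p.Prime) (hp3 : 3 ≤ p) {m : ℕ}
    (hm : 0 < m) (hpm : p.Coprime m) {q : Matrix (Fin n) (Fin n) ℝ} (hq : IsUnitriangular q)
    (hqm : HasDenominator m q) (ha : ∀ i, 0 < a i) {ε : ℝ} (hε0 : 0 < ε)
    (hε1 : ε ≤ 1) (hε : ∀ i j, i < j → a j ≤ ε * a i) {B : ℝ}
    (hεB : (m : ℝ) ^ (2 * n) * (n.factorial * (n * B ^ 2) ^ n) * ε < 1)
    (hr : r ∈ stdSimplex ℝ ι) {γ : ι → Matrix (Fin n) (Fin n) ℝ} (hγ : ∀ s, IsUnitriangular (γ s))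
    (hB : ∀ s i j, |γ s i j| ≤ B) {g : SpecialLinearGroup (Fin n) ℤ}
    (hg : g ∈ congruenceSubgroup n p) {d : Fin n → ℝ}
    (hd : mixedGram a r (fun s => q * realMat g * γ s) = Matrix.diagonal d) :
    g ∈ levelUnipotent n p := by
  have := Fact.mk hp
  have hy : (q * realMat g).det = 1 := by rw [Matrix.det_mul, hq.det, det_realMat, one_mul]
  obtain ⟨σ, hσ⟩ := exists_perm_apply_ne_zero hy
  have hvan : ∀ i j, j < σ i → (q * realMat g) i j = 0 := fun i j =>
    apply_eq_zero_of_mixedGram_diagonal hm hy (hqm.mul_realMat g) ha hε0 hε1 hε hεB hr hγ hB hd hσ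
  have hprod := abs_prod_perm_eq_one hy hvan
  obtain ⟨Q, hQ⟩ := hqm
  have hY : ∀ i j, (m : ℝ) * (q * realMat g) i j = (Q * intMat g) i j := fun i j => by
    rw [Matrix.mul_apply, Matrix.mul_apply, Finset.mul_sum, Int.cast_sum]
    refine Finset.sum_congr rfl fun l _ => ?_
    rw [← mul_assoc, hQ, realMat_apply, Int.cast_mul]
  have hprodZ : |∏ i, (Q * intMat g) i (σ i)| = (m : ℤ) ^ n := by
    have : |∏ i, (((Q * intMat g) i (σ i) : ℤ) : ℝ)| = (m : ℝ) ^ n := by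
      simp_rw [← hY]
      rw [Finset.prod_mul_distrib, abs_mul, hprod]
      simp
    exact_mod_cast this
  have hmod : ∀ i j, (((Q * intMat g) i j : ℤ) : ZMod p) = Q i j := fun i j => by
    rw [Matrix.mul_apply, Int.cast_sum, Finset.sum_eq_single j]
    · rw [Int.cast_mul, mem_congruenceSubgroup.1 hg, Matrix.one_apply_eq, mul_one]
    · intro l _ hl
      rw [Int.cast_mul, mem_congruenceSubgroup.1 hg, Matrix.one_apply_ne hl, mul_zero]
    · simp
  have hmp : ((m : ℤ) : ZMod p) ≠ 0 := by
    rw [Int.cast_natCast, Ne, ZMod.natCast_eq_zero_iff]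
    exact (Nat.Prime.coprime_iff_not_dvd hp).1 hpm
  have hQne : ∀ i, Q i (σ i) ≠ 0 := by
    intro i h0
    have h1 : ((∏ i, (Q * intMat g) i (σ i) : ℤ) : ZMod p) = 0 := by
      rw [Int.cast_prod]
      exact Finset.prod_eq_zero (Finset.mem_univ i) (by rw [hmod, h0, Int.cast_zero])
    have h2 : (((m : ℤ) ^ n : ℤ) : ZMod p) = 0 := by
      rw [← hprodZ]
      rcases abs_choice (∏ i, (Q * intMat g) i (σ i)) with h | h <;> rw [h]
      · exact h1
      · rw [Int.cast_neg, h1, neg_zero]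
    rw [Int.cast_pow] at h2
    exact hmp ((pow_eq_zero_iff (Fin.pos i).ne').1 h2)
  have hσ1 : σ = 1 := perm_eq_one_of_le fun i => by
    by_contra h
    refine hQne i ?_
    have := hQ i (σ i)
    rw [hq.1 (not_le.1 h), mul_zero] at this
    exact_mod_cast this.symm
  subst hσ1
  have hqi : q * q⁻¹ = 1 := Matrix.mul_nonsing_inv _ (by rw [hq.det]; exact isUnit_one)
  have hup : (realMat g).IsUpperTriangular := by
    have h1 : (q * realMat g).IsUpperTriangular := fun i j hij => hvan i j hij
    have h2 := (hq.of_mul_eq_one hqi).1.mul h1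
    rwa [Matrix.nonsing_inv_mul_cancel_left _ _ (by rw [hq.det]; exact isUnit_one)] at h2
  have hupZ : (intMat g).IsUpperTriangular := fun i j hij => by
    have := hup hij
    rw [realMat_apply] at this
    exact_mod_cast this
  refine ⟨hg, hupZ, fun i => ?_⟩
  have hdet := det_intMat g
  rw [Matrix.det_of_isUpperTriangular hupZ] at hdet
  have hunit : IsUnit (intMat g i i) := isUnit_of_dvd_one
    (hdet ▸ Finset.dvd_prod_of_mem (fun i => intMat g i i) (Finset.mem_univ i))
  rcases Int.isUnit_iff.1 hunit with h | h
  · exact h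
  · have h1 := mem_congruenceSubgroup.1 hg i i
    rw [h, Matrix.one_apply_eq] at h1
    have : Fact (2 < p) := ⟨hp3⟩
    exact absurd (by simpa using h1) (ZMod.neg_one_ne_one (n := p))

end UnipotentMixedGram

section UniformBound

variable {n : ℕ} {ι : Type*} [Fintype ι] {a : Fin n → ℝ} {r : ι → ℝ}

lemma abs_apply_le_of_unitriangular_diagonal {N : Matrix (Fin n) (Fin n) ℝ}
    (hN : IsUnitriangular N) {d : Fin n → ℝ} (hd : ∀ i, 0 ≤ d i) (ha : ∀ i, 0 < a i) {C : ℝ}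
    (hC : 0 ≤ C) {ε : ℝ} (hε : ∀ i j, i < j → a j ≤ ε * a i)
    (hεC : n * (2 * C + 1) ^ 2 * C * ε ≤ 1 / 2)
    (hP : ∀ i j, i ≤ j → |∑ l, N i l * d l * N j l| ≤ C * a j)
    (hP' : ∀ j, a j ≤ ∑ l, N j l * d l * N j l) (i j : Fin n) : |N i j| ≤ 2 * C + 1 := by
  suffices H : ∀ j, d j ≤ C * a j ∧ ∀ i, |N i j| ≤ 2 * C + 1 from (H j).2 i
  intro j
  induction j using WellFoundedGT.induction with
  | _ j ih =>
  have hsplit : ∀ i, ∑ l, N i l * d l * N j l =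
      N i j * d j + ∑ l ∈ Finset.Ioi j, N i l * d l * N j l := fun i => by
    rw [← Finset.sum_subset (Finset.subset_univ (Finset.Ici j)), ← Finset.Ioi_insert,
      Finset.sum_insert (by simp), hN.2, mul_one]
    intro l _ hl
    rw [Finset.mem_Ici, not_le] at hl
    rw [hN.1 hl, mul_zero]
  have htail : ∀ i, |∑ l ∈ Finset.Ioi j, N i l * d l * N j l| ≤ a j / 2 := fun i => by
    have haj := ha j
    calc |∑ l ∈ Finset.Ioi j, N i l * d l * N j l|
        ≤ ∑ l ∈ Finset.Ioi j, |N i l * d l * N j l| := Finset.abs_sum_le_sum_abs _ _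
      _ ≤ ∑ l ∈ Finset.Ioi j, (2 * C + 1) ^ 2 * C * |ε * a j| := Finset.sum_le_sum fun l hl => by
          have hjl := Finset.mem_Ioi.1 hl
          have h1 := (ih l hjl).2 i
          have h2 := (ih l hjl).2 j
          have h3 : d l ≤ C * |ε * a j| := (ih l hjl).1.trans
            (mul_le_mul_of_nonneg_left ((hε j l hjl).trans (le_abs_self _)) hC)
          rw [abs_mul, abs_mul, abs_of_nonneg (hd l)]
          calc |N i l| * d l * |N j l| ≤ (2 * C + 1) * (C * |ε * a j|) * (2 * C + 1) := by
                have := hd l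
                gcongr
            _ = _ := by ring
      _ = (Finset.Ioi j).card * ((2 * C + 1) ^ 2 * C * |ε * a j|) := by
          rw [Finset.sum_const, nsmul_eq_mul]
      _ ≤ a j / 2 := by
          rcases (Finset.Ioi j).eq_empty_or_nonempty with h0 | ⟨l, hl⟩
          · rw [h0, Finset.card_empty, Nat.cast_zero, zero_mul]
            positivity
          · have hε0 : 0 < ε * a j := (ha l).trans_le (hε j l (Finset.mem_Ioi.1 hl))
            have hcard : ((Finset.Ioi j).card : ℝ) ≤ n := by
              exact_mod_cast (Finset.card_le_univ _).trans_eq (Fintype.card_fin n)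
            rw [abs_of_pos hε0]
            calc _ ≤ (n : ℝ) * ((2 * C + 1) ^ 2 * C * (ε * a j)) := by gcongr
              _ = (n * (2 * C + 1) ^ 2 * C * ε) * a j := by ring
              _ ≤ 1 / 2 * a j := by gcongr
              _ = a j / 2 := by ring
  have hdj := hsplit j
  rw [hN.2, one_mul] at hdj
  have hlow : a j / 2 ≤ d j := by
    have h1 := hP' j
    have h2 := (abs_le.1 (htail j)).2
    linarith
  refine ⟨?_, fun i => ?_⟩
  · have h1 := (abs_le.1 (hP j j le_rfl)).2
    have h2 : 0 ≤ ∑ l ∈ Finset.Ioi j, N j l * d l * N j l := Finset.sum_nonneg fun l _ => by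
      have := mul_nonneg (sq_nonneg (N j l)) (hd l)
      nlinarith
    linarith
  · rcases lt_or_ge j i with hij | hij
    · rw [hN.1 hij, abs_zero]
      linarith
    · have h1 := hP i j hij
      have h2 := htail i
      have h3 : |N i j| * d j ≤ C * a j + a j / 2 := by
        rw [← abs_of_nonneg (hd j), ← abs_mul]
        calc |N i j * d j| = |(∑ l, N i l * d l * N j l) -
              ∑ l ∈ Finset.Ioi j, N i l * d l * N j l| := by rw [hsplit, add_sub_cancel_right]
          _ ≤ _ := (abs_sub _ _).trans (add_le_add h1 h2)
      have h4 : |N i j| * (a j / 2) ≤ C * a j + a j / 2 :=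
        (mul_le_mul_of_nonneg_left hlow (abs_nonneg _)).trans h3
      have haj := ha j
      by_contra hlt
      rw [not_le] at hlt
      nlinarith

lemma abs_realMat_inv_le {ε : ℝ} (hε1 : ε ≤ 1) (ha : ∀ i, 0 < a i)
    (hε : ∀ i j, i < j → a j ≤ ε * a i) {B : ℝ}
    (hεB : n * (2 * (n * B ^ 2) + 1) ^ 2 * (n * B ^ 2) * ε ≤ 1 / 2)
    {q : Matrix (Fin n) (Fin n) ℝ} (hq : IsUnitriangular q) {Q : ℝ} (hQ : ∀ i j, |q i j| ≤ Q)
    (hr : r ∈ stdSimplex ℝ ι) {γ : ι → Matrix (Fin n) (Fin n) ℝ} (hγ : ∀ s, IsUnitriangular (γ s))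
    (hB : ∀ s i j, |γ s i j| ≤ B) {v : SpecialLinearGroup (Fin n) ℤ}
    (hv : IsUnitriangular (realMat v)) {d : Fin n → ℝ}
    (hd : mixedGram a r (fun s => q * realMat v * γ s) = Matrix.diagonal d) (i j : Fin n) :
    |realMat v⁻¹ i j| ≤ n * ((2 * (n * B ^ 2) + 1) * Q) := by
  have hanti : Antitone a := fun i j h => by
    rcases h.eq_or_lt with rfl | h
    · exact le_rfl
    · have := hε i j h
      have := ha i
      nlinarith
  set y := q * realMat v
  have hyT : IsUnitriangular y := hq.mul hv
  have hyu : IsUnit y.det := by rw [hyT.det]; exact isUnit_one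
  have hNT : IsUnitriangular y⁻¹ := hyT.of_mul_eq_one (Matrix.mul_nonsing_inv _ hyu)
  have hP : mixedGram a r γ = y⁻¹ * Matrix.diagonal d * (y⁻¹)ᵀ := by
    rw [← hd, mixedGram_mul, Matrix.transpose_nonsing_inv, ← Matrix.mul_assoc,
      Matrix.nonsing_inv_mul_cancel_left _ _ hyu, Matrix.mul_assoc,
      Matrix.mul_nonsing_inv _ (by rwa [Matrix.det_transpose]), Matrix.mul_one]
  have hP' : ∀ i j, mixedGram a r γ i j = ∑ l, y⁻¹ i l * d l * y⁻¹ j l := fun i j => by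
    rw [hP, mul_diagonal_mul_transpose_apply]
  have hd0 : ∀ i, 0 ≤ d i := fun i => by
    have : d i = mixedGram a r (fun s => y * γ s) i i := by rw [hd, Matrix.diagonal_apply_eq]
    rw [this]
    refine le_mixedGram_diag hr fun s => Finset.sum_nonneg fun l _ => ?_
    have := mul_nonneg (sq_nonneg ((y * γ s) i l)) (ha l).le
    nlinarith
  have hbound : ∀ i j, |y⁻¹ i j| ≤ 2 * (n * B ^ 2) + 1 := by
    refine abs_apply_le_of_unitriangular_diagonal hNT hd0 ha (by positivity) hε hεB ?_ ?_
    · intro i j _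
      rw [← hP', mixedGram_comm]
      exact abs_mixedGram_le hr fun s => abs_sum_unitriangular_le (hγ s) (hB s) ha hanti j i
    · intro j
      rw [← hP']
      refine le_mixedGram_diag hr fun s => le_trans ?_ (le_sum_mul_self (fun l => (ha l).le) _ j j)
      rw [(hγ s).2, one_pow, one_mul]
  have hv' : realMat v⁻¹ = y⁻¹ * q := by
    have h1 : y * realMat v⁻¹ = q := by
      rw [Matrix.mul_assoc, ← realMat_mul, mul_inv_cancel, realMat_one, Matrix.mul_one]
    rw [← h1, Matrix.nonsing_inv_mul_cancel_left _ _ hyu]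
  rw [hv']
  exact abs_mul_apply_le hbound hQ i j

end UniformBound

section WeightVec

variable {n p : ℕ} {ι : Type*} [Fintype ι]

/-- The entries above the diagonal of `Y * diagonal (ε ^ l) * Yᵀ`, rescaled by the weight of their
column. -/
noncomputable def weightVec (ε : ℝ) (Y : Matrix (Fin n) (Fin n) ℝ) : Fin (n * (n - 1) / 2) → ℝ :=
  fun a => (Y * Matrix.diagonal (fun l : Fin n => ε ^ (l : ℕ)) * Yᵀ) (posRow a) (posCol a) /
    ε ^ (posCol a : ℕ)

lemma exists_mixedGram_eq_diagonal {ε : ℝ} (hε : ε ≠ 0) {r : ι → ℝ}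
    {Y : ι → Matrix (Fin n) (Fin n) ℝ} (h : ∑ s, r s • weightVec ε (Y s) = 0) :
    ∃ d, mixedGram (fun l : Fin n => ε ^ (l : ℕ)) r Y = Matrix.diagonal d := by
  have hup : ∀ i j : Fin n, i < j → mixedGram (fun l : Fin n => ε ^ (l : ℕ)) r Y i j = 0 := by
    intro i j hij
    obtain ⟨a, rfl, rfl⟩ := exists_pos hij
    have h1 := congrFun h a
    simp only [Finset.sum_apply, Pi.smul_apply, weightVec, smul_eq_mul, Pi.zero_apply,
      mul_diagonal_mul_transpose_apply, mul_div_assoc', ← Finset.sum_div] at h1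
    rw [mixedGram_apply]
    exact (div_eq_zero_iff.1 h1).resolve_right (pow_ne_zero _ hε)
  refine ⟨fun i => mixedGram (fun l : Fin n => ε ^ (l : ℕ)) r Y i i, Matrix.ext fun i j => ?_⟩
  rcases lt_trichotomy i j with hij | rfl | hij
  · rw [hup i j hij, Matrix.diagonal_apply_ne _ hij.ne]
  · rw [Matrix.diagonal_apply_eq]
  · rw [mixedGram_comm, hup j i hij, Matrix.diagonal_apply_ne _ hij.ne']

lemma weightVec_of_isUnitriangular {ε : ℝ} (hε : ε ≠ 0) {Y : Matrix (Fin n) (Fin n) ℝ}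
    (hY : IsUnitriangular Y) :
    weightVec ε Y = fun a => ∑ l, Y (posRow a) l * Y (posCol a) l * ε ^ ((l : ℕ) - posCol a) := by
  funext a
  rw [weightVec, mul_diagonal_mul_transpose_apply, Finset.sum_div]
  refine Finset.sum_congr rfl fun l _ => ?_
  rcases lt_or_ge l (posCol a) with h | h
  · simp [hY.1 h]
  · rw [div_eq_iff (pow_ne_zero _ hε), mul_assoc (_ * _) (ε ^ _), ← pow_add, Nat.sub_add_cancel h]
    ring

lemma sum_mul_zero_pow_of_isUnitriangular {Y : Matrix (Fin n) (Fin n) ℝ}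
    (hY : IsUnitriangular Y) :
    (fun a => ∑ l, Y (posRow a) l * Y (posCol a) l * (0 : ℝ) ^ ((l : ℕ) - posCol a)) =
      posVec Y := by
  funext a
  rw [Finset.sum_eq_single (posCol a), hY.2, Nat.sub_self, pow_zero, mul_one, mul_one]
  · rfl
  · intro l _ hl
    rcases lt_or_gt_of_ne hl with h | h
    · rw [hY.1 h, mul_zero, zero_mul]
    · have h1 : (posCol a : ℕ) < l := h
      rw [zero_pow (by omega), mul_zero]
  · simp

lemma continuous_posMatrix :
    Continuous (posMatrix : (Fin (n * (n - 1) / 2) → ℝ) → Matrix (Fin n) (Fin n) ℝ) := by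
  refine continuous_matrix fun i j => ?_
  simp only [posMatrix, Matrix.of_apply]
  split_ifs <;> fun_prop

lemma tendsto_weightVec (t₀ : Fin (n * (n - 1) / 2) → ℝ) (v : levelUnipotent n p) :
    Tendsto (fun e : (Fin (n * (n - 1) / 2) → ℝ) × ℝ => weightVec e.2 (posMatrix e.1 * realMat v.1))
      (𝓝 t₀ ×ˢ 𝓝[>] 0) (𝓝 (posVec (posMatrix t₀ * realMat v.1))) := by
  have hT : ∀ t, IsUnitriangular (posMatrix t * realMat v.1) := fun t =>
    (isUnitriangular_posMatrix t).mul (isUnitriangular_realMat v)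
  have hc : Continuous fun e : (Fin (n * (n - 1) / 2) → ℝ) × ℝ => fun a : Fin (n * (n - 1) / 2) =>
      ∑ l, (posMatrix e.1 * realMat v.1) (posRow a) l * (posMatrix e.1 * realMat v.1) (posCol a) l *
        e.2 ^ ((l : ℕ) - posCol a) := by
    have hm : Continuous fun e : (Fin (n * (n - 1) / 2) → ℝ) × ℝ => posMatrix e.1 * realMat v.1 :=
      (continuous_posMatrix.comp continuous_fst).matrix_mul continuous_const
    refine continuous_pi fun a => continuous_finsetSum _ fun l _ => ?_
    exact ((hm.matrix_elem _ _).mul (hm.matrix_elem _ _)).mul (continuous_snd.pow _)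
  have h1 := hc.tendsto (t₀, 0)
  simp only [sum_mul_zero_pow_of_isUnitriangular (hT t₀)] at h1
  rw [nhds_prod_eq] at h1
  refine (h1.mono_left (Filter.prod_mono le_rfl nhdsWithin_le_nhds)).congr' ?_
  have h2 : ∀ᶠ e : (Fin (n * (n - 1) / 2) → ℝ) × ℝ in 𝓝 t₀ ×ˢ 𝓝[>] 0, e.2 ∈ Set.Ioi (0 : ℝ) :=
    tendsto_snd.eventually self_mem_nhdsWithin
  exact h2.mono fun e he => (weightVec_of_isUnitriangular (ne_of_gt he) (hT e.1)).symm

lemma posVec_one : posVec (1 : Matrix (Fin n) (Fin n) ℝ) = 0 :=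
  funext fun a => Matrix.one_apply_ne (posRow_lt_posCol a).ne

lemma exists_posMatrix_mul_eq_one (y : Fin (n * (n - 1) / 2) → ℝ) :
    ∃ t, posMatrix t * posMatrix y = 1 := by
  have h : posMatrix y * (posMatrix y)⁻¹ = 1 :=
    Matrix.mul_nonsing_inv _ (by rw [(isUnitriangular_posMatrix y).det]; exact isUnit_one)
  refine ⟨posVec (posMatrix y)⁻¹, ?_⟩
  rw [posMatrix_posVec ((isUnitriangular_posMatrix y).of_mul_eq_one h)]
  exact mul_eq_one_comm.1 h

/-- Near the boundary the coboundary of the cone cochain counts lattice simplices. -/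
lemma eventually_coboundary_coneCochain_weightVec {y t₀ : Fin (n * (n - 1) / 2) → ℝ}
    (ht₀ : posMatrix t₀ * posMatrix y = 1)
    {x : Fin (n * (n - 1) / 2 + 1) → levelUnipotent n p}
    (hx : ∀ c : Fin (n * (n - 1) / 2 + 1) → ℝ, ∑ j, c j = 1 →
      ∑ j, c j • posVec (realMat (x j).1) = y → ∀ i, c i ≠ 0) :
    ∀ᶠ e : (Fin (n * (n - 1) / 2) → ℝ) × ℝ in 𝓝 t₀ ×ˢ 𝓝[>] 0, ∀ u,
      IsGenericFor u (fun i => weightVec e.2 (posMatrix e.1 * realMat (x i).1)) →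
        coboundary (coneCochain u) (fun i => weightVec e.2 (posMatrix e.1 * realMat (x i).1)) =
          latticeSign y x := by
  have hL : (posLin (posMatrix t₀)).det = 1 := det_posLin (isUnitriangular_posMatrix t₀)
  have hw : ∀ i, posVec (posMatrix t₀ * realMat (x i).1) =
      posLin (posMatrix t₀) *ᵥ (posVec (realMat (x i).1) - y) := fun i => by
    have := posVec_mul_sub (isUnitriangular_posMatrix t₀) (isUnitriangular_realMat (x i))
      (isUnitriangular_posMatrix y)
    rwa [ht₀, posVec_one, sub_zero, posVec_posMatrix] at this
  have hsign : commonSign (fun i => posVec (posMatrix t₀ * realMat (x i).1)) = latticeSign y x := by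
    simp only [hw]
    rw [commonSign_mulVec (by rw [hL]; exact one_ne_zero), hL]
    simp [latticeSign]
  have hgen : ∀ c : Fin (n * (n - 1) / 2 + 1) → ℝ, ∑ j, c j = 1 →
      ∑ j, c j • posVec (posMatrix t₀ * realMat (x j).1) = 0 → ∀ i, c i ≠ 0 := by
    intro c hc hc0
    refine hx c hc ?_
    simp only [hw, ← Matrix.mulVec_smul, ← Matrix.mulVec_sum] at hc0
    have h1 := Matrix.eq_zero_of_mulVec_eq_zero (by rw [hL]; exact one_ne_zero) hc0
    simp only [smul_sub, Finset.sum_sub_distrib, ← Finset.sum_smul, hc, one_smul] at h1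
    exact sub_eq_zero.1 h1
  have htend := tendsto_pi_nhds.2 fun i => tendsto_weightVec t₀ (x i)
  rw [← hsign]
  exact htend.eventually (eventually_coboundary_coneCochain_eq hgen)

end WeightVec

section NearBoundary

variable {n p : ℕ} {ι : Type*} [Fintype ι]

lemma exists_forall_abs_realMat_le (x : ι → levelUnipotent n p) :
    ∃ B, ∀ s i j, |realMat (x s).1 i j| ≤ B := by
  choose C hC using fun s => exists_abs_apply_le (realMat (x s).1)
  obtain ⟨B, hB⟩ := Finite.exists_le C
  exact ⟨B, fun s i j => (hC s i j).trans (hB s)⟩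

lemma pow_le_mul_pow {ε : ℝ} (hε0 : 0 ≤ ε) (hε1 : ε ≤ 1) {i j : Fin n} (h : i < j) :
    ε ^ (j : ℕ) ≤ ε * ε ^ (i : ℕ) := by
  rw [← pow_succ']
  exact pow_le_pow_of_le_one hε0 hε1 h

lemma eventually_mul_lt {C D : ℝ} (hD : 0 < D) : ∀ᶠ ε in 𝓝[>] (0 : ℝ), C * ε < D := by
  have h : Tendsto (fun ε : ℝ => C * ε) (𝓝 0) (𝓝 (C * 0)) := (continuous_const_mul C).tendsto 0
  rw [mul_zero] at h
  exact (h.eventually_lt_const hD).filter_mono nhdsWithin_le_nhds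

/-- Near the boundary, only elements of the unitriangular subgroup move a given simplex of
unitriangular matrices to one that surrounds the origin. -/
lemma eventually_mem_levelUnipotent (hp : p.Prime) (hp3 : 3 ≤ p) {m : ℕ} (hm : 0 < m)
    (hpm : p.Coprime m) {t : Fin (n * (n - 1) / 2) → ℝ} (ht : HasDenominator m (posMatrix t))
    (x : ι → levelUnipotent n p) :
    ∀ᶠ ε in 𝓝[>] (0 : ℝ), ∀ g ∈ congruenceSubgroup n p,
      (∃ r ∈ stdSimplex ℝ ι,
        ∑ s, r s • weightVec ε (posMatrix t * realMat (g * (x s).1)) = 0) →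
      g ∈ levelUnipotent n p := by
  obtain ⟨B, hB⟩ := exists_forall_abs_realMat_le x
  filter_upwards [self_mem_nhdsWithin, Ioc_mem_nhdsGT one_pos,
    eventually_mul_lt (C := (m : ℝ) ^ (2 * n) * (n.factorial * (n * B ^ 2) ^ n)) one_pos]
    with ε hε0 hε1 hεB g hg
  rintro ⟨r, hr, h0⟩
  have hε0 : 0 < ε := hε0
  obtain ⟨d, hd⟩ := exists_mixedGram_eq_diagonal hε0.ne' h0
  simp only [realMat_mul, ← Matrix.mul_assoc] at hd
  exact mem_levelUnipotent_of_mixedGram_diagonal hp hp3 hm hpm (isUnitriangular_posMatrix t) ht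
    (fun i => pow_pos hε0 _) hε0 hε1.2 (fun i j h => pow_le_mul_pow hε0.le hε1.2 h) hεB hr
    (fun s => isUnitriangular_realMat (x s)) hB hg hd

lemma exists_finset_eventually_mem (t₀ : Fin (n * (n - 1) / 2) → ℝ) (x : ι → levelUnipotent n p) :
    ∃ S : Finset (levelUnipotent n p),
      ∀ᶠ e : (Fin (n * (n - 1) / 2) → ℝ) × ℝ in 𝓝 t₀ ×ˢ 𝓝[>] 0, ∀ v : levelUnipotent n p,
        (∃ r ∈ stdSimplex ℝ ι,
          ∑ s, r s • weightVec e.2 (posMatrix e.1 * realMat (v.1 * (x s).1)) = 0) → v ∈ S := by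
  obtain ⟨B, hB⟩ := exists_forall_abs_realMat_le x
  obtain ⟨Q, hQ⟩ := exists_abs_apply_le (posMatrix t₀)
  have hfin : {v : levelUnipotent n p | ∀ i j, |realMat v⁻¹.1 i j| ≤
      n * ((2 * (n * B ^ 2) + 1) * (Q + 1))}.Finite :=
    (finite_setOf_abs_realMat_le _).preimage
      (Subtype.val_injective.comp inv_injective).injOn
  refine ⟨hfin.toFinset, ?_⟩
  have hev : ∀ᶠ t in 𝓝 t₀, ∀ i j, |posMatrix t i j| ≤ Q + 1 := by
    refine eventually_all.2 fun i => eventually_all.2 fun j => ?_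
    have hc : Continuous fun t : Fin (n * (n - 1) / 2) → ℝ => |posMatrix t i j| :=
      (continuous_posMatrix.matrix_elem i j).abs
    exact (hc.tendsto t₀).eventually_le_const ((hQ i j).trans_lt (lt_add_one Q))
  filter_upwards [tendsto_fst.eventually hev, tendsto_snd.eventually self_mem_nhdsWithin,
    tendsto_snd.eventually (Ioc_mem_nhdsGT one_pos),
    tendsto_snd.eventually (eventually_mul_lt
      (C := n * (2 * (n * B ^ 2) + 1) ^ 2 * (n * B ^ 2)) one_half_pos)]
    with e he hε0 hε1 hεB v
  rintro ⟨r, hr, h0⟩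
  have hε0 : 0 < e.2 := hε0
  obtain ⟨d, hd⟩ := exists_mixedGram_eq_diagonal hε0.ne' h0
  simp only [realMat_mul, ← Matrix.mul_assoc] at hd
  rw [Set.Finite.mem_toFinset]
  exact abs_realMat_inv_le hε1.2 (fun i => pow_pos hε0 _)
    (fun i j h => pow_le_mul_pow hε0.le hε1.2 h) hεB.le (isUnitriangular_posMatrix e.1) he hr
    (fun s => isUnitriangular_realMat (x s)) hB (isUnitriangular_realMat v) hd

lemma exists_hasDenominator_posMatrix_mem (hp : p ≠ 0) {t₀ : Fin (n * (n - 1) / 2) → ℝ}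
    {U : Set (Fin (n * (n - 1) / 2) → ℝ)} (hU : U ∈ 𝓝 t₀) :
    ∃ t ∈ U, ∃ m : ℕ, 0 < m ∧ p.Coprime m ∧ HasDenominator m (posMatrix t) := by
  obtain ⟨δ, hδ, hball⟩ := Metric.mem_nhds_iff.1 hU
  obtain ⟨N, hN⟩ := exists_nat_one_div_lt hδ
  set m := p * (N + 1) + 1
  have hm : (0 : ℝ) < m := by positivity
  refine ⟨fun a => ⌊(m : ℝ) * t₀ a⌋ / m, hball ?_, m, by positivity, by simp [m], ?_⟩
  · rw [Metric.mem_ball, dist_pi_lt_iff hδ]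
    intro a
    refine lt_of_le_of_lt ?_ hN
    have h1 := Int.floor_le ((m : ℝ) * t₀ a)
    have h2 := (Int.lt_floor_add_one ((m : ℝ) * t₀ a)).le
    have h3 : ((N : ℝ) + 1) ≤ m := by
      have : N + 1 ≤ m := by
        have := Nat.le_mul_of_pos_left (N + 1) (Nat.pos_of_ne_zero hp)
        omega
      exact_mod_cast this
    have h4 : |(⌊(m : ℝ) * t₀ a⌋ / m : ℝ) - t₀ a| ≤ 1 / m := by
      rw [le_div_iff₀ hm, ← abs_of_pos hm, ← abs_mul, abs_of_pos hm, sub_mul,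
        div_mul_cancel₀ _ hm.ne', abs_le]
      constructor <;> linarith
    rw [Real.dist_eq]
    exact h4.trans (one_div_le_one_div_of_le (by positivity) h3)
  · refine ⟨Matrix.of fun i j => if h : i < j then
      ⌊(m : ℝ) * t₀ ((posEquiv n).symm ⟨(i, j), h⟩)⌋ else if i = j then m else 0, fun i j => ?_⟩
    simp only [posMatrix, Matrix.of_apply]
    split_ifs
    · rw [mul_div_cancel₀ _ hm.ne']
    · simp
    · simp

end NearBoundary

lemma HomogeneousCochain.nontrivial_groupCohomology_of_ne_zero {Γ : Type} [Group Γ] {k : ℕ}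
    (hk : k ≠ 0) {c : (Fin (k + 1) → Γ) → ℚ} (hc : IsInvariant ⊤ c) (hδ : coboundary c = 0)
    (hne : ∀ b : (Fin k → Γ) → ℚ, IsInvariant ⊤ b → coboundary b ≠ c) :
    Nontrivial (groupCohomology (Rep.trivial ℚ Γ ℚ) k) := by
  obtain ⟨m, rfl⟩ := Nat.exists_eq_succ_of_ne_zero hk
  exact nontrivial_groupCohomology hc hδ hne

section Cocycle

variable {n p : ℕ}

/-- The pullback of the cone cochain along the weighted Gram matrices is a cocycle with finite
support on every orbit. -/
noncomputable def gramCochain (p : ℕ) (u : Fin (n * (n - 1) / 2) → ℝ) (ε : ℝ)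
    (q : Matrix (Fin n) (Fin n) ℝ)
    (x : Fin (n * (n - 1) / 2 + 1) → congruenceSubgroup n p) : ℚ :=
  coboundary (coneCochain u) fun i => weightVec ε (q * realMat (x i).1)

lemma coboundary_gramCochain (u : Fin (n * (n - 1) / 2) → ℝ) (ε : ℝ)
    (q : Matrix (Fin n) (Fin n) ℝ) : coboundary (gramCochain p u ε q) = 0 :=
  coboundary_coboundary fun x : Fin (n * (n - 1) / 2) → congruenceSubgroup n p =>
    coneCochain u fun i => weightVec ε (q * realMat (x i).1)

lemma exists_mem_stdSimplex_of_gramCochain_ne_zero {u : Fin (n * (n - 1) / 2) → ℝ} {ε : ℝ}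
    {q : Matrix (Fin n) (Fin n) ℝ}
    (hu : ∀ x : Fin (n * (n - 1) / 2 + 1) → SpecialLinearGroup (Fin n) ℤ,
      IsGenericFor u fun i => weightVec ε (q * realMat (x i)))
    {x : Fin (n * (n - 1) / 2 + 1) → congruenceSubgroup n p} (h : gramCochain p u ε q x ≠ 0) :
    ∃ r ∈ stdSimplex ℝ (Fin (n * (n - 1) / 2 + 1)),
      ∑ s, r s • weightVec ε (q * realMat (x s).1) = 0 :=
  exists_mem_stdSimplex_of_coboundary_ne_zero (hu fun i => (x i).1) h

lemma finite_setOf_gramCochain_ne_zero {u : Fin (n * (n - 1) / 2) → ℝ} {ε : ℝ} (hε : 0 < ε)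
    {q : Matrix (Fin n) (Fin n) ℝ} (hq : q.det = 1) {m : ℕ} (hm : 0 < m)
    (hqm : HasDenominator m q)
    (hu : ∀ x : Fin (n * (n - 1) / 2 + 1) → SpecialLinearGroup (Fin n) ℤ,
      IsGenericFor u fun i => weightVec ε (q * realMat (x i)))
    (x : Fin (n * (n - 1) / 2 + 1) → congruenceSubgroup n p) :
    {g : congruenceSubgroup n p | gramCochain p u ε q (fun i => g * x i) ≠ 0}.Finite := by
  refine ((finite_setOf_mixedGram_diagonal hq hm hqm (fun i => pow_pos hε (i : ℕ))
    fun i => (x i).1).preimage Subtype.val_injective.injOn).subset fun g hg => ?_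
  obtain ⟨r, hr, h0⟩ := exists_mem_stdSimplex_of_gramCochain_ne_zero hu hg
  exact ⟨r, hr, exists_mixedGram_eq_diagonal hε.ne' h0⟩

lemma exists_gramCochain (hp : p.Prime) (hp3 : 3 ≤ p) (hn : 2 ≤ n)
    {y : Fin (n * (n - 1) / 2) → ℝ}
    (hy : ∀ (x : Fin (n * (n - 1) / 2 + 1) → levelUnipotent n p)
      (c : Fin (n * (n - 1) / 2 + 1) → ℝ),
      ∑ j, c j = 1 → ∑ j, c j • posVec (realMat (x j).1) = y → ∀ i, c i ≠ 0)
    (X : Finset (Fin (n * (n - 1) / 2 + 1) → levelUnipotent n p)) :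
    ∃ f : (Fin (n * (n - 1) / 2 + 1) → congruenceSubgroup n p) → ℚ, coboundary f = 0 ∧
      (∀ x : Fin (n * (n - 1) / 2 + 1) → congruenceSubgroup n p,
        {g | f (fun i => g * x i) ≠ 0}.Finite) ∧
      ∃ S : Finset (levelUnipotent n p), ∀ x ∈ X,
        (∀ g, f (fun i => g * Subgroup.inclusion levelUnipotent_le (x i)) ≠ 0 →
          ∃ v ∈ S, Subgroup.inclusion levelUnipotent_le v = g) ∧
        (∀ v ∈ S, f (fun i => Subgroup.inclusion levelUnipotent_le (v * x i)) =
          latticeSign y fun i => v * x i) ∧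
        ∀ v ∉ S, latticeSign y (fun i => v * x i) = 0 := by
  have hk : n * (n - 1) / 2 ≠ 0 := by
    have : 2 * 1 ≤ n * (n - 1) := Nat.mul_le_mul hn (by omega)
    omega
  obtain ⟨t₀, ht₀⟩ := exists_posMatrix_mul_eq_one y
  choose S₁ hS₁ using exists_finset_eventually_mem (p := p) (n := n)
    (ι := Fin (n * (n - 1) / 2 + 1)) t₀
  set S := X.biUnion S₁
  have hS : ∀ᶠ e : (Fin (n * (n - 1) / 2) → ℝ) × ℝ in 𝓝 t₀ ×ˢ 𝓝[>] 0, ∀ x ∈ X,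
      ∀ v : levelUnipotent n p, (∃ r ∈ stdSimplex ℝ (Fin (n * (n - 1) / 2 + 1)),
        ∑ s, r s • weightVec e.2 (posMatrix e.1 * realMat (v.1 * (x s).1)) = 0) → v ∈ S :=
    (eventually_all_finset X).2 fun x hx => (hS₁ x).mono fun e he v hv =>
      Finset.mem_biUnion.2 ⟨x, hx, he v hv⟩
  have hval : ∀ᶠ e : (Fin (n * (n - 1) / 2) → ℝ) × ℝ in 𝓝 t₀ ×ˢ 𝓝[>] 0, ∀ x ∈ X, ∀ v ∈ S, ∀ u,
      IsGenericFor u (fun i => weightVec e.2 (posMatrix e.1 * realMat (v * x i).1)) →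
        coboundary (coneCochain u)
          (fun i => weightVec e.2 (posMatrix e.1 * realMat (v * x i).1)) =
          latticeSign y fun i => v * x i :=
    (eventually_all_finset X).2 fun x _ => (eventually_all_finset S).2 fun v _ =>
      eventually_coboundary_coneCochain_weightVec ht₀ (hy _)
  have hgen : ∀ e : (Fin (n * (n - 1) / 2) → ℝ) × ℝ, ∃ u,
      ∀ x : Fin (n * (n - 1) / 2 + 1) → SpecialLinearGroup (Fin n) ℤ,
        IsGenericFor u fun i => weightVec e.2 (posMatrix e.1 * realMat (x i)) := fun e =>
    exists_forall_isGenericFor hk _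
  have hout : ∀ x ∈ X, ∀ v ∉ S, latticeSign y (fun i => v * x i) = 0 := by
    intro x hx v hv
    by_contra h0
    obtain ⟨e, he, he'⟩ := (hS.and (eventually_coboundary_coneCochain_weightVec ht₀
      (hy fun i => v * x i))).exists
    obtain ⟨u, hu⟩ := hgen e
    rw [← he' u (hu fun i => (v * x i).1)] at h0
    exact hv (he x hx v (exists_mem_stdSimplex_of_coboundary_ne_zero
      (hu fun i => (v * x i).1) h0))
  obtain ⟨t, ht, m, hm, hpm, htm⟩ := exists_hasDenominator_posMatrix_mem hp.ne_zero
    (hS.and hval).curry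
  have hΓ := (eventually_all_finset X).2 fun x _ =>
    eventually_mem_levelUnipotent hp hp3 hm hpm htm x
  rw [Set.mem_ofPred_eq] at ht
  obtain ⟨ε, ⟨⟨hS', hval'⟩, hΓ'⟩, hε⟩ := ((ht.and hΓ).and self_mem_nhdsWithin).exists
  obtain ⟨u, hu⟩ := hgen (t, ε)
  refine ⟨gramCochain p u ε (posMatrix t), coboundary_gramCochain u ε _,
    finite_setOf_gramCochain_ne_zero hε (isUnitriangular_posMatrix t).det hm htm hu, S,
    fun x hx => ⟨fun g hg => ?_, fun v hv => ?_, hout x hx⟩⟩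
  · have h0 := exists_mem_stdSimplex_of_gramCochain_ne_zero hu hg
    have hgU := hΓ' x hx g.1 g.2 h0
    exact ⟨⟨g.1, hgU⟩, hS' x hx ⟨g.1, hgU⟩ h0, rfl⟩
  · exact hval' x hx v hv u (hu fun i => (v * x i).1)

lemma orbitSum_inclusion {G : Type*} [Group G] {H K : Subgroup G} (hHK : H ≤ K) {k : ℕ}
    {f : (Fin k → K) → ℚ} {x : Fin k → H} {S : Finset H}
    (hS : ∀ g, f (fun i => g * Subgroup.inclusion hHK (x i)) ≠ 0 →
      ∃ v ∈ S, Subgroup.inclusion hHK v = g) :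
    orbitSum f (fun i => Subgroup.inclusion hHK (x i)) =
      ∑ v ∈ S, f fun i => Subgroup.inclusion hHK (v * x i) := by
  classical
  rw [orbitSum, finsum_eq_sum_of_support_subset (s := S.image (Subgroup.inclusion hHK)) _
    (fun g hg => by simpa using hS g hg), Finset.sum_image (Subgroup.inclusion_injective hHK).injOn]
  simp only [map_mul]

end Cocycle

/-- **Miller–Patzt–Putman.** Let `p ≥ 5` be a prime and let `Γ_n(p)` be the level-`p`
principal congruence subgroup of `SL_n(ℤ)`, i.e. the kernel of the reduction map
`SL_n(ℤ) → SL_n(ℤ/pℤ)`. Then for every `n ≥ 2`, the rational cohomology of `Γ_n(p)` in its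
virtual cohomological dimension `n(n−1)/2` is nonzero. -/
theorem congruence_subgroup_top_cohomology_nonzero
    (p : ℕ) (hp : p.Prime) (hp5 : 5 ≤ p) (n : ℕ) (hn : 2 ≤ n) :
    Nontrivial
      (groupCohomology
        (Rep.trivial ℚ
          (↥((Matrix.SpecialLinearGroup.map (n := Fin n)
            (Int.castRingHom (ZMod p))).ker)) ℚ)
        (n * (n - 1) / 2)) := by
  have hk : n * (n - 1) / 2 ≠ 0 := by
    have : 2 * 1 ≤ n * (n - 1) := Nat.mul_le_mul hn (by omega)
    omega
  obtain ⟨z, hz, hz0⟩ := HomogeneousCochain.exists_cycle fun b hb =>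
    coboundary_ne_detCochain_posCoord hp.ne_zero hn b hb
  obtain ⟨y, hy, hsum⟩ := exists_generic_point hp.ne_zero z hz0
  obtain ⟨f, hδ, hfin, S, hS⟩ := exists_gramCochain hp (by omega) hn hy z.support
  refine HomogeneousCochain.nontrivial_groupCohomology_of_ne_zero hk
    (HomogeneousCochain.isInvariant_orbitSum f) (HomogeneousCochain.coboundary_orbitSum hfin hδ)
    fun b hb hbf => hsum ?_
  have hcyc := hz (fun x => b fun i => Subgroup.inclusion levelUnipotent_le (x i))
    fun h _ x => by
      have := hb (Subgroup.inclusion levelUnipotent_le h) trivial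
        fun i => Subgroup.inclusion levelUnipotent_le (x i)
      simpa only [map_mul] using this
  have hval : ∀ x ∈ z.support, HomogeneousCochain.coboundary
      (fun x => b fun i => Subgroup.inclusion levelUnipotent_le (x i)) x =
        ∑ v ∈ S, latticeSign y fun i => v * x i := fun x hx => by
    rw [← Finset.sum_congr rfl (hS x hx).2.1, ← orbitSum_inclusion levelUnipotent_le (hS x hx).1,
      ← hbf]
    rfl
  rw [Finsupp.linearCombination_apply, Finsupp.sum,
    Finset.sum_congr rfl fun x hx => congrArg (z x • ·) (hval x hx)] at hcyc
  rw [tsum_eq_sum (s := S) fun v hv => Finset.sum_eq_zero fun x hx => by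
    rw [(hS x hx).2.2 v hv, Rat.cast_zero, mul_zero], Finset.sum_comm]
  simp only [← Finset.mul_sum]
  exact_mod_cast hcyc
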